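/- arXiv:2409.06640 — 2 statements merged into one kernel-verified Lean document; each statement's English description precedes it below -/
import Mathlib

section
/- For every Δ ∈ ℕ and every α > 0 there exists n₀ ∈ ℕ such that the following holds for all n ≥ n₀: let G be an n-vertex graph with δ(G) ≥ (1/2+α)n, let T be an n-vertex tree with Δ(T) ≤ Δ, let t ∈ V(T) and v ∈ V(G). Then G contains a copy of T in which t is copied to v, i.e. there is an injective graph homomorphism φ : V(T) → V(G) with φ(t) = v. -/
/-- A rooted tree structure on `X`, given by its parent map and depth function.
The root is its own parent. -/
structure ParentTree (X : Type*) where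
  root : X
  par : X → X
  depth : X → ℕ
  par_root : par root = root
  depth_par : ∀ x, x ≠ root → depth (par x) + 1 = depth x

namespace ParentTree

variable {X V : Type*} {τ : ParentTree X}

lemma par_ne {x : X} (hx : x ≠ τ.root) : τ.par x ≠ x := by
  intro h
  have := τ.depth_par x hx
  rw [h] at this
  omega

lemma depth_par_lt {x : X} (hx : x ≠ τ.root) : τ.depth (τ.par x) < τ.depth x := by
  have := τ.depth_par x hx
  omega

lemma iterate_root (k : ℕ) : τ.par^[k] τ.root = τ.root := by
  induction k with
  | zero => rfl
  | succ k ih => rw [Function.iterate_succ_apply, τ.par_root, ih]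

variable [DecidableEq X] (τ)

/-- A set of vertices spanning a subtree that contains the root. -/
structure IsClosed (D : Finset X) : Prop where
  root_mem : τ.root ∈ D
  par_mem : ∀ x ∈ D, τ.par x ∈ D

/-- The set `P` spans a subtree with root `r`, and `r` is a child of a vertex of `D`. -/
structure Attached (D P : Finset X) (r : X) : Prop where
  disj : Disjoint D P
  mem : r ∈ P
  par_root_mem : τ.par r ∈ D
  par_mem : ∀ x ∈ P, x ≠ r → τ.par x ∈ P

/-- `Build K S D₀ D` says that `D` arises from `D₀` by successively attaching subtrees whose
sizes lie between `K` and `S`. -/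
inductive Build (K S : ℕ) (D₀ : Finset X) : Finset X → Prop
  | refl : Build K S D₀ D₀
  | step {D P : Finset X} {r : X} : Build K S D₀ D → τ.Attached D P r → K ≤ P.card →
      P.card ≤ S → Build K S D₀ (D ∪ P)

/-- `φ` restricts to an embedding of the subtree spanned by `D` into `G`. -/
structure IsEmb (G : SimpleGraph V) (D : Finset X) (φ : X → V) : Prop where
  inj : Set.InjOn φ D
  adj : ∀ x ∈ D, x ≠ τ.root → G.Adj (φ (τ.par x)) (φ x)

/-- The children of a vertex. -/
def children [Fintype X] (x : X) : Finset X :=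
  Finset.univ.filter fun y => y ≠ τ.root ∧ τ.par y = x

variable {τ}

lemma mem_children [Fintype X] {x y : X} :
    y ∈ τ.children x ↔ y ≠ τ.root ∧ τ.par y = x := by
  simp [children]

lemma depth_iterate_le (k : ℕ) (x : X) : τ.depth (τ.par^[k] x) ≤ τ.depth x := by
  induction k with
  | zero => simp
  | succ k ih =>
    rw [Function.iterate_succ_apply']
    by_cases h : τ.par^[k] x = τ.root
    · rw [h, τ.par_root, ← h]; exact ih
    · exact (depth_par_lt h).le.trans ih

lemma exists_iterate_eq_root (x : X) : ∃ k, τ.par^[k] x = τ.root := by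
  induction h : τ.depth x using Nat.strong_induction_on generalizing x with
  | _ d ih =>
    by_cases hx : x = τ.root
    · exact ⟨0, hx⟩
    · obtain ⟨k, hk⟩ := ih _ (h ▸ depth_par_lt hx) (τ.par x) rfl
      exact ⟨k + 1, hk⟩

lemma IsClosed.union {D P : Finset X} {r : X} (hD : τ.IsClosed D) (hP : τ.Attached D P r) :
    τ.IsClosed (D ∪ P) := by
  refine ⟨Finset.mem_union_left _ hD.root_mem, fun x hx => ?_⟩
  rcases Finset.mem_union.1 hx with hx | hx
  · exact Finset.mem_union_left _ (hD.par_mem x hx)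
  · by_cases h : x = r
    · exact Finset.mem_union_left _ (h ▸ hP.par_root_mem)
    · exact Finset.mem_union_right _ (hP.par_mem x hx h)

lemma Build.subset {K S : ℕ} {D₀ D : Finset X} (h : τ.Build K S D₀ D) : D₀ ⊆ D := by
  induction h with
  | refl => exact subset_rfl
  | step _ _ _ _ ih => exact ih.trans Finset.subset_union_left

lemma Build.trans {K S : ℕ} {D₀ D₁ D : Finset X} (h₀ : τ.Build K S D₀ D₁)
    (h : τ.Build K S D₁ D) : τ.Build K S D₀ D := by
  induction h with
  | refl => exact h₀
  | step _ hP hK hS ih => exact .step ih hP hK hS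

lemma Build.isClosed {K S : ℕ} {D₀ D : Finset X} (h : τ.Build K S D₀ D) (h₀ : τ.IsClosed D₀) :
    τ.IsClosed D := by
  induction h with
  | refl => exact h₀
  | step _ hP _ _ ih => exact ih.union hP

/-- Few vertices of `D` hang directly below `D₀` if `D` is built from `D₀` by large subtrees. -/
lemma Build.card_hanging_le {K S : ℕ} {D₀ D : Finset X} (h : τ.Build K S D₀ D) :
    K * (D.filter fun x => x ∉ D₀ ∧ τ.par x ∈ D₀).card + D₀.card ≤ D.card := by
  induction h with
  | refl => simp +contextual [Finset.filter_eq_empty_iff.2]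
  | @step D P r hB hP hK _ ih =>
    have hsub := hB.subset
    have h1 : ((D ∪ P).filter fun x => x ∉ D₀ ∧ τ.par x ∈ D₀) ⊆
        insert r (D.filter fun x => x ∉ D₀ ∧ τ.par x ∈ D₀) := by
      intro x hx
      simp only [Finset.mem_filter, Finset.mem_union, Finset.mem_insert] at hx ⊢
      obtain ⟨hx | hx, hx'⟩ := hx
      · exact .inr ⟨hx, hx'⟩
      · by_contra hne
        push Not at hne
        exact Finset.disjoint_left.1 hP.disj (hsub hx'.2) (hP.par_mem x hx hne.1)
    have h2 := (Finset.card_le_card h1).trans (Finset.card_insert_le _ _)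
    rw [Finset.card_union_of_disjoint hP.disj]
    nlinarith

/-- A subtree of more than `Δ * K + 1` vertices has a pendant subtree with between `K` and
`Δ * K + 1` vertices. -/
lemma exists_pendant_subtree [Fintype X] {Δ K : ℕ} (hΔ : ∀ x, (τ.children x).card ≤ Δ)
    {D : Finset X} (hD : τ.IsClosed D) (hK : Δ * K + 1 < D.card) (hKD : K ≤ D.card) :
    ∃ P ⊆ D, ∃ r, τ.IsClosed (D \ P) ∧ τ.Attached (D \ P) P r ∧ K ≤ P.card ∧
      P.card ≤ Δ * K + 1 := by
  classical
  let desc : X → Finset X := fun x => D.filter fun y => ∃ k, τ.par^[k] y = x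
  have hroot : desc τ.root = D :=
    Finset.filter_true_of_mem fun y _ => exists_iterate_eq_root y
  obtain ⟨x, hx, hmax⟩ := Finset.exists_max_image (D.filter fun x => K ≤ (desc x).card) τ.depth
    ⟨τ.root, by simp [hD.root_mem, hroot, hKD]⟩
  simp only [Finset.mem_filter, and_imp] at hx hmax
  have hstep : ∀ y ∈ desc x, y ≠ x → y ≠ τ.root → τ.par y ∈ desc x := by
    intro y hy hyx _
    simp only [desc, Finset.mem_filter] at hy ⊢
    obtain ⟨hyD, k, hk⟩ := hy
    refine ⟨hD.par_mem y hyD, ?_⟩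
    cases k with
    | zero => exact absurd hk hyx
    | succ k => exact ⟨k, hk⟩
  have hcard : (desc x).card ≤ Δ * K + 1 := by
    have hsub : desc x ⊆ insert x (((τ.children x).filter (· ∈ D)).biUnion desc) := by
      intro y hy
      simp only [desc, Finset.mem_filter] at hy
      obtain ⟨hyD, k, hk⟩ := hy
      clear hstep hmax
      rw [Finset.mem_insert, Finset.mem_biUnion]
      suffices h : ∀ k (z : X), z ∈ D → (∃ j, τ.par^[j] y = z) → τ.par^[k] z = x →
          y = x ∨ z = x ∨ ∃ c ∈ (τ.children x).filter (· ∈ D), y ∈ desc c by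
        rcases h k y hyD ⟨0, rfl⟩ hk with h | h | h
        · exact .inl h
        · exact .inl h
        · exact .inr h
      intro k
      induction k with
      | zero => intro z _ _ h; exact .inr (.inl h)
      | succ k ih =>
        intro z hz ⟨j, hj⟩ h
        rcases ih (τ.par z) (hD.par_mem z hz) ⟨j + 1, by
          rw [Function.iterate_succ_apply', hj]⟩ h with h | h | h
        · exact .inl h
        · by_cases hzr : z = τ.root
          · subst hzr
            rw [τ.par_root] at h
            exact .inr (.inl h)
          · refine .inr (.inr ⟨z, ?_, ?_⟩)
            · simp [mem_children, hzr, h, hz]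
            · simp only [desc, Finset.mem_filter]
              exact ⟨hyD, j, hj⟩
        · exact .inr (.inr h)
    refine (Finset.card_le_card hsub).trans ((Finset.card_insert_le _ _).trans ?_)
    gcongr
    refine (Finset.card_biUnion_le_card_mul _ _ K ?_).trans
      (Nat.mul_le_mul_right _ ((Finset.card_filter_le _ _).trans (hΔ x)))
    intro c hc
    simp only [Finset.mem_filter, mem_children] at hc
    by_contra hlt
    push Not at hlt
    have := hmax c hc.2 hlt.le
    have := depth_par_lt hc.1.1
    rw [hc.1.2] at this
    omega
  have hxr : x ≠ τ.root := by
    rintro rfl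
    rw [hroot] at hcard
    omega
  have hroot_notMem : τ.root ∉ desc x := by
    simp only [desc, Finset.mem_filter, not_and, not_exists, iterate_root]
    exact fun _ _ h => hxr h.symm
  refine ⟨desc x, Finset.filter_subset _ _, x, ⟨?_, ?_⟩, ⟨?_, ?_, ?_, ?_⟩, hx.2, hcard⟩
  · exact Finset.mem_sdiff.2 ⟨hD.root_mem, hroot_notMem⟩
  · intro y hy
    rw [Finset.mem_sdiff] at hy ⊢
    refine ⟨hD.par_mem y hy.1, fun h => hy.2 ?_⟩
    simp only [desc, Finset.mem_filter] at h ⊢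
    obtain ⟨_, k, hk⟩ := h
    exact ⟨hy.1, k + 1, hk⟩
  · exact Finset.sdiff_disjoint
  · simp only [desc, Finset.mem_filter]
    exact ⟨hx.1, 0, rfl⟩
  · rw [Finset.mem_sdiff]
    refine ⟨hD.par_mem x hx.1, fun h => ?_⟩
    simp only [desc, Finset.mem_filter] at h
    obtain ⟨_, k, hk⟩ := h
    have h1 := depth_iterate_le (τ := τ) k (τ.par x)
    rw [hk] at h1
    have := depth_par_lt hxr
    omega
  · exact fun y hy hyx => hstep y hy hyx fun h => hroot_notMem (h ▸ hy)

lemma exists_build [Fintype X] {Δ K N : ℕ} (hΔ : ∀ x, (τ.children x).card ≤ Δ)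
    (hN : Δ * K + 1 ≤ N) (hKN : K ≤ N) (D : Finset X) (hD : τ.IsClosed D) (hND : N ≤ D.card) :
    ∃ D₀, τ.IsClosed D₀ ∧ D₀.card ≤ N ∧ N ≤ D₀.card + (Δ * K + 1) ∧
      τ.Build K (Δ * K + 1) D₀ D := by
  induction h : D.card using Nat.strong_induction_on generalizing D with
  | _ d ih =>
    rcases hND.eq_or_lt with heq | hlt
    · exact ⟨D, hD, heq.ge, by omega, .refl⟩
    · obtain ⟨P, hPD, r, hcl, hP, hKP, hPS⟩ :=
        exists_pendant_subtree hΔ hD (by omega) (by omega : K ≤ D.card)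
      have hcard := Finset.card_sdiff_add_card_eq_card hPD
      have hPpos : 0 < P.card := Finset.card_pos.2 ⟨r, hP.mem⟩
      have hunion : D \ P ∪ P = D := Finset.sdiff_union_of_subset hPD
      by_cases hN' : N ≤ (D \ P).card
      · obtain ⟨D₀, h1, h2, h3, h4⟩ := ih _ (by omega) (D \ P) hcl hN' rfl
        exact ⟨D₀, h1, h2, h3, hunion ▸ h4.step hP hKP hPS⟩
      · exact ⟨D \ P, hcl, by omega, by omega, by
          simpa only [hunion] using Build.refl.step hP hKP hPS⟩

end ParentTree

namespace ParentTree
variable {X V : Type*} [DecidableEq X] {τ : ParentTree X}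

/-- Greedy embedding of a subtree in which every vertex is assigned a set of candidates. -/
lemma exists_greedy_embedding [DecidableEq V] (G : SimpleGraph V) [DecidableRel G.Adj] (N : ℕ)
    (B : X → Finset V) (r : X) (v : V) (hv : v ∈ B r) (P : Finset X) (hr : r ∈ P)
    (hpar : ∀ x ∈ P, x ≠ r → τ.par x ∈ P) (hroot : ∀ x ∈ P, x ≠ r → x ≠ τ.root)
    (hN : P.card ≤ N)
    (hB : ∀ x ∈ P, x ≠ r → (τ.par x ≠ r → ∀ u ∈ B (τ.par x),
      N ≤ ((B x).filter (G.Adj u)).card) ∧ (τ.par x = r → N ≤ ((B x).filter (G.Adj v)).card)) :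
    ∃ ψ : X → V, Set.InjOn ψ P ∧ ψ r = v ∧ (∀ x ∈ P, ψ x ∈ B x) ∧
      ∀ x ∈ P, x ≠ r → G.Adj (ψ (τ.par x)) (ψ x) := by
  induction h : P.card generalizing P with
  | zero => simp [Finset.card_eq_zero.1 h] at hr
  | succ k ih =>
    obtain ⟨y, hy, hmax⟩ := Finset.exists_max_image P τ.depth ⟨r, hr⟩
    by_cases hyr : y = r
    · have hP : ∀ x ∈ P, x = r := by
        intro x hx
        by_contra hne
        suffices ∀ n x, x ∈ P → x ≠ r → τ.depth x = n → False from this _ x hx hne rfl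
        intro n
        induction n using Nat.strong_induction_on with
        | _ n ihn =>
          intro x hx hne hn
          have hlt := depth_par_lt (hroot x hx hne)
          by_cases hpr : τ.par x = r
          · have := hmax x hx
            rw [hyr, ← hpr] at this
            omega
          · exact ihn _ (hn ▸ hlt) _ (hpar x hx hne) hpr rfl
      refine ⟨fun _ => v, fun a ha b hb _ => (hP a ha).trans (hP b hb).symm, rfl, ?_, ?_⟩
      · exact fun x hx => (hP x hx).symm ▸ hv
      · exact fun x hx hne => absurd (hP x hx) hne
    · have hpy : ∀ x ∈ P, x ≠ r → τ.par x ≠ y := by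
        intro x hx hne he
        have := depth_par_lt (hroot x hx hne)
        have := hmax x hx
        rw [he] at *
        omega
      have hcard : (P.erase y).card = k := by rw [Finset.card_erase_of_mem hy, h]; rfl
      obtain ⟨ψ, hinj, hψr, hψB, hψadj⟩ := ih (P.erase y)
        (Finset.mem_erase.2 ⟨Ne.symm hyr, hr⟩)
        (fun x hx hne => Finset.mem_erase.2
          ⟨hpy x (Finset.mem_of_mem_erase hx) hne, hpar x (Finset.mem_of_mem_erase hx) hne⟩)
        (fun x hx => hroot x (Finset.mem_of_mem_erase hx))
        (by omega) (fun x hx => hB x (Finset.mem_of_mem_erase hx)) hcard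
      have hpmem : τ.par y ∈ P.erase y :=
        Finset.mem_erase.2 ⟨hpy y hy hyr, hpar y hy hyr⟩
      have hlarge : N ≤ ((B y).filter (G.Adj (ψ (τ.par y)))).card := by
        by_cases hp : τ.par y = r
        · rw [hp, hψr]; exact (hB y hy hyr).2 hp
        · exact (hB y hy hyr).1 hp _ (hψB _ hpmem)
      obtain ⟨u, hu, hu'⟩ := Finset.exists_mem_notMem_of_card_lt_card
        (s := (P.erase y).image ψ) (t := (B y).filter (G.Adj (ψ (τ.par y))))
        (by have := Finset.card_image_le (s := P.erase y) (f := ψ); omega)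
      rw [Finset.mem_filter] at hu
      have hne : ∀ x ∈ P.erase y, Function.update ψ y u x = ψ x := fun x hx =>
        Function.update_of_ne (Finset.ne_of_mem_erase hx) _ _
      refine ⟨Function.update ψ y u, ?_, ?_, ?_, ?_⟩
      · rw [← Finset.insert_erase hy, Finset.coe_insert, Set.injOn_insert (by simp)]
        refine ⟨hinj.congr fun x hx => (hne x hx).symm, ?_⟩
        rintro ⟨x, hx, hxu⟩
        rw [Function.update_self, hne x hx] at hxu
        exact hu' (hxu ▸ Finset.mem_image_of_mem ψ hx)
      · rw [Function.update_of_ne (Ne.symm hyr), hψr]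
      · intro x hx
        by_cases hxy : x = y
        · subst hxy; simpa using hu.1
        · rw [Function.update_of_ne hxy]; exact hψB x (Finset.mem_erase.2 ⟨hxy, hx⟩)
      · intro x hx hxr
        rw [Function.update_of_ne (hpy x hx hxr)]
        by_cases hxy : x = y
        · subst hxy; simpa using hu.2
        · rw [Function.update_of_ne hxy]; exact hψadj x (Finset.mem_erase.2 ⟨hxy, hx⟩) hxr

end ParentTree

/-- A dense bipartite graph contains a nonempty subgraph of large minimum degree. -/
lemma exists_core_of_dense {V : Type*} [DecidableEq V] (G : SimpleGraph V) [DecidableRel G.Adj]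
    (d : ℕ) (A L : Finset V)
    (h : d * (A.card + L.card) < ∑ a ∈ A, (L.filter (G.Adj a)).card) :
    ∃ A' ⊆ A, ∃ L' ⊆ L, A'.Nonempty ∧ (∀ a ∈ A', d ≤ (L'.filter (G.Adj a)).card) ∧
      ∀ l ∈ L', d ≤ (A'.filter (G.Adj l)).card := by
  induction hn : A.card + L.card generalizing A L with
  | zero =>
    have : A = ∅ := Finset.card_eq_zero.1 (by omega)
    simp [this] at h
  | succ n ih =>
    by_cases hA : ∃ a ∈ A, (L.filter (G.Adj a)).card < d
    · obtain ⟨a, ha, had⟩ := hA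
      have hc : (A.erase a).card + L.card = n := by
        rw [Finset.card_erase_of_mem ha]
        have := Finset.card_pos.2 ⟨a, ha⟩
        omega
      obtain ⟨A', hA', L', hL', h'⟩ := ih (A.erase a) L (by
        rw [← Finset.add_sum_erase _ _ ha, hn] at h
        rw [hc]
        linarith [mul_add d n 1]) hc
      exact ⟨A', hA'.trans (Finset.erase_subset _ _), L', hL', h'⟩
    by_cases hL : ∃ l ∈ L, (A.filter (G.Adj l)).card < d
    · obtain ⟨l, hl, hld⟩ := hL
      have hc : A.card + (L.erase l).card = n := by
        rw [Finset.card_erase_of_mem hl]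
        have := Finset.card_pos.2 ⟨l, hl⟩
        omega
      have hsum : ∑ a ∈ A, (L.filter (G.Adj a)).card =
          ∑ a ∈ A, ((L.erase l).filter (G.Adj a)).card + (A.filter (G.Adj l)).card := by
        rw [Finset.card_filter (G.Adj l) A, ← Finset.sum_add_distrib]
        refine Finset.sum_congr rfl fun a _ => ?_
        rw [Finset.card_filter, Finset.card_filter, ← Finset.sum_erase_add _ _ hl]
        simp only [G.adj_comm]
      obtain ⟨A', hA', L', hL', h'⟩ := ih A (L.erase l) (by
        rw [hsum, hn] at h
        rw [hc]
        linarith [mul_add d n 1]) hc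
      exact ⟨A', hA', L', hL'.trans (Finset.erase_subset _ _), h'⟩
    push Not at hA hL
    refine ⟨A, subset_rfl, L, subset_rfl, ?_, hA, hL⟩
    by_contra hne
    simp [Finset.not_nonempty_iff_eq_empty.1 hne] at h

/-- Existence of quantiles of a function on a finite set. -/
lemma exists_quantile {V : Type*} (U : Finset V) (g : V → ℝ) {c : ℝ} (hc : 0 < c)
    (hcU : c ≤ U.card) :
    ∃ u ∈ U, c ≤ (U.filter fun w => g w ≤ g u).card ∧
      ((U.filter fun w => g w < g u).card : ℝ) < c := by
  classical
  have hne : U.Nonempty := Finset.card_pos.1 (by exact_mod_cast hc.trans_le hcU)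
  obtain ⟨a, ha, hmax⟩ := Finset.exists_max_image U g hne
  obtain ⟨u, hu, hmin⟩ := Finset.exists_min_image
    (U.filter fun u => c ≤ (U.filter fun w => g w ≤ g u).card) g
    ⟨a, by rw [Finset.mem_filter, Finset.filter_true_of_mem hmax]; exact ⟨ha, hcU⟩⟩
  rw [Finset.mem_filter] at hu
  refine ⟨u, hu.1, hu.2, ?_⟩
  by_contra! hlt
  obtain ⟨b, hb, hbmax⟩ := Finset.exists_max_image (U.filter fun w => g w < g u) g
    (Finset.card_pos.1 (by exact_mod_cast hc.trans_le hlt))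
  rw [Finset.mem_filter] at hb
  refine absurd (hmin b (Finset.mem_filter.2 ⟨hb.1, hlt.trans ?_⟩)) (not_le.2 hb.2)
  refine Nat.cast_le.2 (Finset.card_le_card fun w hw => Finset.mem_filter.2
    ⟨(Finset.mem_filter.1 hw).1, hbmax w hw⟩)

/-- Two sets occupying together more than a finite set `U` have a large intersection. -/
lemma card_filter_inter_ge {V : Type*} [DecidableEq V] (U : Finset V) (p q : V → Prop)
    [DecidablePred p] [DecidablePred q] :
    ((U.filter p).card : ℝ) + (U.filter q).card - U.card ≤
      ((U.filter q).filter p).card := by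
  have h1 : (U.filter p).card + (U.filter q).card ≤
      U.card + ((U.filter q).filter p).card := by
    rw [← Finset.card_union_add_card_inter, Finset.filter_filter, ← Finset.filter_or,
      ← Finset.filter_and]
    simp only [and_comm]
    gcongr
    exact Finset.filter_subset _ _
  have : ((U.filter p).card : ℝ) + (U.filter q).card ≤
      U.card + ((U.filter q).filter p).card := by exact_mod_cast h1
  linarith

/-- If all degrees into `U` exceed `|U| / 2`, every vertex `z` has a neighbour in `U` which is
adjacent to a positive proportion of a given set `E`. -/
lemma exists_adj_rich {V : Type*} [DecidableEq V] (G : SimpleGraph V) [DecidableRel G.Adj]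
    (U : Finset V) {a : ℝ} (ha : 0 < a) (hU : U.Nonempty)
    (hdeg : ∀ v, (1 / 2 + a) * U.card ≤ (U.filter (G.Adj v)).card) (E : Finset V) (z : V) :
    ∃ x ∈ U, G.Adj z x ∧ 2 * a * E.card ≤ (E.filter (G.Adj x)).card := by
  have hUpos : (0 : ℝ) < U.card := by exact_mod_cast Finset.card_pos.2 hU
  have hne : (U.filter (G.Adj z)).Nonempty := by
    rw [← Finset.card_pos]
    have := hdeg z
    have h0 : (0 : ℝ) < (U.filter (G.Adj z)).card := lt_of_lt_of_le (by positivity) this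
    exact_mod_cast h0
  by_contra! hcon
  have hle : (∑ x ∈ U.filter (G.Adj z), ((E.filter (G.Adj x)).card : ℝ)) <
      ∑ x ∈ U.filter (G.Adj z), 2 * a * E.card :=
    Finset.sum_lt_sum_of_nonempty hne fun x hx =>
      hcon x (Finset.mem_filter.1 hx).1 (Finset.mem_filter.1 hx).2
  have hcomm : (∑ x ∈ U.filter (G.Adj z), ((E.filter (G.Adj x)).card : ℝ)) =
      ∑ e ∈ E, (((U.filter (G.Adj z)).filter (G.Adj e)).card : ℝ) := by
    simp only [Finset.card_filter, Nat.cast_sum]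
    rw [Finset.sum_comm]
    simp only [G.adj_comm]
  have hge : ∑ e ∈ E, 2 * a * (U.card : ℝ) ≤
      ∑ e ∈ E, (((U.filter (G.Adj z)).filter (G.Adj e)).card : ℝ) := by
    refine Finset.sum_le_sum fun e _ => ?_
    have := card_filter_inter_ge U (G.Adj e) (G.Adj z)
    linarith [hdeg e, hdeg z]
  rw [hcomm] at hle
  simp only [Finset.sum_const, nsmul_eq_mul] at hle hge
  have hz : ((U.filter (G.Adj z)).card : ℝ) ≤ U.card := by
    exact_mod_cast Finset.card_filter_le _ _
  have : ((U.filter (G.Adj z)).card : ℝ) * (2 * a * E.card) ≤ U.card * (2 * a * E.card) := by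
    gcongr
  nlinarith

namespace ParentTree
variable {X V : Type*} [DecidableEq X] {τ : ParentTree X}

/-- A small subtree can be attached at `z` so that, apart from its root, its vertices of odd
and even height lie in prescribed sets `E₁` and `E₂`. -/
lemma exists_bipartite_embedding [DecidableEq V] (G : SimpleGraph V) [DecidableRel G.Adj]
    (U : Finset V) {a : ℝ} (ha : 0 < a) (hU : U.Nonempty)
    (hdeg : ∀ v, (1 / 2 + a) * U.card ≤ (U.filter (G.Adj v)).card)
    {D P : Finset X} {r : X} (hD : τ.IsClosed D) (hP : τ.Attached D P r) (z : V) (d : ℕ)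
    (hd : (P.card : ℝ) ≤ 2 * a * d) (hPd : P.card ≤ d) (E₁ E₂ : Finset V) (hE₁ : E₁ ⊆ U)
    (hE₂ : E₂ ⊆ U) (hd₁ : ∀ e ∈ E₁, d ≤ (E₂.filter (G.Adj e)).card)
    (hd₂ : ∀ e ∈ E₂, d ≤ (E₁.filter (G.Adj e)).card) (hne : E₂.Nonempty) :
    ∃ ψ : X → V, Set.InjOn ψ P ∧ (∀ x ∈ P, ψ x ∈ U) ∧ G.Adj z (ψ r) ∧
      (∀ x ∈ P, x ≠ r → G.Adj (ψ (τ.par x)) (ψ x)) ∧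
      ∀ x ∈ P.erase r, ψ x ∈ if τ.depth x % 2 = τ.depth r % 2 then E₂ else E₁ := by
  obtain ⟨e, he⟩ := hne
  have hE₁card : d ≤ E₁.card := (hd₂ e he).trans (Finset.card_filter_le _ _)
  obtain ⟨v, hvU, hzv, hv⟩ := exists_adj_rich G U ha hU hdeg E₁ z
  have hv' : P.card ≤ (E₁.filter (G.Adj v)).card := by
    have h1 : (d : ℝ) ≤ E₁.card := by exact_mod_cast hE₁card
    have h2 : 2 * a * d ≤ 2 * a * E₁.card := by gcongr
    exact_mod_cast hd.trans (h2.trans hv)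
  have hroot : ∀ x ∈ P, x ≠ τ.root := fun x hx h =>
    Finset.disjoint_left.1 hP.disj hD.root_mem (h ▸ hx)
  obtain ⟨ψ, hinj, hψr, hψB, hψadj⟩ := exists_greedy_embedding (τ := τ) G P.card
    (fun x => if x = r then {v} else if τ.depth x % 2 = τ.depth r % 2 then E₂ else E₁)
    r v (by simp) P hP.mem hP.par_mem (fun x hx _ => hroot x hx) le_rfl (by
      intro x hx hxr
      have hdep := τ.depth_par x (hroot x hx)
      refine ⟨fun hpr => ?_, fun hpr => ?_⟩
      · simp only [if_neg hxr, if_neg hpr]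
        by_cases h : τ.depth x % 2 = τ.depth r % 2
        · rw [if_neg (by omega), if_pos h]
          exact fun u hu => hPd.trans (hd₁ u hu)
        · rw [if_pos (by omega), if_neg h]
          exact fun u hu => hPd.trans (hd₂ u hu)
      · rw [hpr] at hdep
        simp only [if_neg hxr]
        rwa [if_neg (by omega)])
  refine ⟨ψ, hinj, ?_, hψr.symm ▸ hzv, hψadj, ?_⟩
  · intro x hx
    have := hψB x hx
    split_ifs at this
    · rw [Finset.mem_singleton.1 this]; exact hvU
    · exact hE₂ this
    · exact hE₁ this
  · intro x hx
    rw [Finset.mem_erase] at hx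
    have := hψB x hx.2
    rwa [if_neg hx.1] at this

/-- A small subtree can be attached at `z` so that the average of a cost function over its image
hardly exceeds the average over all available vertices. -/
lemma exists_cheap_embedding [DecidableEq V] (G : SimpleGraph V) [DecidableRel G.Adj]
    (U : Finset V) {a ε : ℝ} (ha : 0 < a) (hε : 0 < ε) (hε2 : ε ≤ 1 / 2)
    (hdeg : ∀ v, (1 / 2 + a) * U.card ≤ (U.filter (G.Adj v)).card)
    (g : V → ℝ) (hg0 : ∀ v, 0 ≤ g v) (hg1 : ∀ v, g v ≤ 1)
    {D P : Finset X} {r : X} (hD : τ.IsClosed D) (hP : τ.Attached D P r) (z : V) (d : ℕ)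
    (hd : (P.card : ℝ) ≤ 2 * a * d) (hPd : P.card ≤ d) (hUd : 2 * d < ε * a * U.card) :
    ∃ ψ : X → V, Set.InjOn ψ P ∧ (∀ x ∈ P, ψ x ∈ U) ∧ G.Adj z (ψ r) ∧
      (∀ x ∈ P, x ≠ r → G.Adj (ψ (τ.par x)) (ψ x)) ∧
      U.card * ∑ x ∈ P, g (ψ x) ≤ P.card * ∑ u ∈ U, g u + U.card * (1 + ε * P.card) := by
  have hUpos : (0 : ℝ) < U.card := by
    have : (0 : ℝ) < ε * a * U.card := lt_of_le_of_lt (by positivity) hUd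
    exact (pos_iff_pos_of_mul_pos this).1 (by positivity)
  have hU : U.Nonempty := Finset.card_pos.1 (by exact_mod_cast hUpos)
  obtain ⟨uθ, -, hθ1, hθ2⟩ := exists_quantile U g (c := U.card / 2) (by positivity) (by linarith)
  obtain ⟨uη, -, hη1, hη2⟩ := exists_quantile U g (c := ε * U.card) (by positivity) (by nlinarith)
  set θ := g uθ
  set η := g uη
  set m : ℝ := (U.card : ℝ) with hm
  have hηθ : η ≤ θ := by
    by_contra! hlt
    have : ((U.filter fun w => g w ≤ θ).card : ℝ) ≤ (U.filter fun w => g w < η).card :=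
      Nat.cast_le.2 (Finset.card_le_card
        (Finset.monotone_filter_right _ fun w _ hw => lt_of_le_of_lt hw hlt))
    nlinarith
  have hη0 : 0 ≤ η := hg0 _
  have hη1' : η ≤ 1 := hg1 _
  have hsum : m * ((θ + η) / 2) - ε * m ≤ ∑ u ∈ U, g u := by
    have h1 : ∑ u ∈ U, (θ - (θ - η) * (if g u < θ then 1 else 0) - η * if g u < η then 1 else 0) ≤
        ∑ u ∈ U, g u := by
      refine Finset.sum_le_sum fun u _ => ?_
      have := hg0 u
      split_ifs <;> linarith
    rw [Finset.sum_sub_distrib, Finset.sum_sub_distrib, ← Finset.mul_sum, ← Finset.mul_sum,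
      Finset.sum_boole, Finset.sum_boole, Finset.sum_const, nsmul_eq_mul, ← hm] at h1
    have h2 : (θ - η) * ((U.filter fun w => g w < θ).card : ℝ) ≤ (θ - η) * (m / 2) :=
      mul_le_mul_of_nonneg_left hθ2.le (sub_nonneg.2 hηθ)
    have h3 : η * ((U.filter fun w => g w < η).card : ℝ) ≤ 1 * (ε * m) :=
      mul_le_mul hη1' hη2.le (by positivity) (by norm_num)
    linarith
  obtain ⟨A, hA, L, hL, hAne, hAd, hLd⟩ := exists_core_of_dense G d
    (U.filter fun w => g w ≤ η) (U.filter fun w => g w ≤ θ) (by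
      have h1 : ∑ x ∈ U.filter (fun w => g w ≤ η), a * m ≤
          ∑ x ∈ U.filter (fun w => g w ≤ η),
            (((U.filter fun w => g w ≤ θ).filter (G.Adj x)).card : ℝ) := by
        refine Finset.sum_le_sum fun x _ => ?_
        have := card_filter_inter_ge U (G.Adj x) (fun w => g w ≤ θ)
        have := hdeg x
        linarith
      rw [Finset.sum_const, nsmul_eq_mul] at h1
      have h2 : ((U.filter fun w => g w ≤ η).card : ℝ) ≤ m :=
        Nat.cast_le.2 (Finset.card_filter_le _ _)
      have h3 : ((U.filter fun w => g w ≤ θ).card : ℝ) ≤ m :=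
        Nat.cast_le.2 (Finset.card_filter_le _ _)
      have h4 : (d : ℝ) * (((U.filter fun w => g w ≤ η).card : ℝ) +
          (U.filter fun w => g w ≤ θ).card) ≤ d * (m + m) := by gcongr
      have h5 : ε * m * (a * m) ≤ ((U.filter fun w => g w ≤ η).card : ℝ) * (a * m) := by gcongr
      have h6 : 2 * d * m < ε * a * m * m := by gcongr
      have h7 : (d : ℝ) * (((U.filter fun w => g w ≤ η).card : ℝ) +
          (U.filter fun w => g w ≤ θ).card) < ∑ x ∈ U.filter (fun w => g w ≤ η),
            (((U.filter fun w => g w ≤ θ).filter (G.Adj x)).card : ℝ) := by linarith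
      exact_mod_cast h7)
  have hdpos : 0 < d := (Finset.card_pos.2 ⟨r, hP.mem⟩).trans_le hPd
  have hLne : L.Nonempty := by
    obtain ⟨x, hx⟩ := hAne
    have := (hAd x hx).trans (Finset.card_filter_le _ _)
    exact Finset.card_pos.1 (by omega)
  have hAη : ∀ v ∈ A, g v ≤ η := fun v hv => (Finset.mem_filter.1 (hA hv)).2
  have hLθ : ∀ v ∈ L, g v ≤ θ := fun v hv => (Finset.mem_filter.1 (hL hv)).2
  have hAU : A ⊆ U := hA.trans (Finset.filter_subset _ _)
  have hLU : L ⊆ U := hL.trans (Finset.filter_subset _ _)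
  set ev := (P.erase r).filter fun x => τ.depth x % 2 = τ.depth r % 2
  set od := (P.erase r).filter fun x => ¬ τ.depth x % 2 = τ.depth r % 2
  have hcards : (ev.card : ℝ) + od.card + 1 = P.card := by
    have h1 : ev.card + od.card = (P.erase r).card := Finset.card_filter_add_card_filter_not _
    have h2 := Finset.card_erase_add_one hP.mem
    exact_mod_cast h1 ▸ h2
  have hcost : ∀ (ψ : X → V) (E₁ E₂ : Finset V) (q₁ q₂ : ℝ), (∀ v ∈ E₁, g v ≤ q₁) →
      (∀ v ∈ E₂, g v ≤ q₂) → (∀ x ∈ P.erase r,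
        ψ x ∈ if τ.depth x % 2 = τ.depth r % 2 then E₂ else E₁) →
      ∑ x ∈ P, g (ψ x) ≤ 1 + ev.card * q₂ + od.card * q₁ := by
    intro ψ E₁ E₂ q₁ q₂ h₁ h₂ hψ
    rw [← Finset.add_sum_erase _ _ hP.mem, add_assoc,
      ← Finset.sum_filter_add_sum_filter_not (P.erase r)
        (fun x => τ.depth x % 2 = τ.depth r % 2)]
    refine add_le_add (hg1 _) (add_le_add ?_ ?_)
    · rw [← nsmul_eq_mul]
      refine Finset.sum_le_card_nsmul _ _ _ fun x hx => h₂ _ ?_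
      rw [Finset.mem_filter] at hx
      simpa [hx.2] using hψ x hx.1
    · rw [← nsmul_eq_mul]
      refine Finset.sum_le_card_nsmul _ _ _ fun x hx => h₁ _ ?_
      rw [Finset.mem_filter] at hx
      simpa [hx.2] using hψ x hx.1
  have hfinish : ∀ C : ℝ, C ≤ 1 + ((P.card : ℝ) - 1) * ((θ + η) / 2) →
      m * C ≤ P.card * ∑ u ∈ U, g u + m * (1 + ε * P.card) := by
    intro C hC
    have hP1 : (1 : ℝ) ≤ P.card := by exact_mod_cast Finset.card_pos.2 ⟨r, hP.mem⟩
    have h1 : (P.card : ℝ) * (m * ((θ + η) / 2) - ε * m) ≤ P.card * ∑ u ∈ U, g u := by gcongr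
    have h2 : m * C ≤ m * (1 + ((P.card : ℝ) - 1) * ((θ + η) / 2)) := by gcongr
    have h3 : 0 ≤ m * ((θ + η) / 2) := by
      have : 0 ≤ θ := hg0 _
      positivity
    nlinarith
  by_cases hbal : (ev.card : ℝ) ≤ od.card
  · obtain ⟨ψ, h1, h2, h3, h4, h5⟩ := exists_bipartite_embedding G U ha hU hdeg hD hP z d hd hPd
      A L hAU hLU hAd hLd hLne
    refine ⟨ψ, h1, h2, h3, h4, hfinish _ ((hcost ψ A L η θ hAη hLθ h5).trans ?_)⟩
    rw [← hcards]
    nlinarith [mul_nonneg (sub_nonneg.2 hbal) (sub_nonneg.2 hηθ)]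
  · push Not at hbal
    obtain ⟨ψ, h1, h2, h3, h4, h5⟩ := exists_bipartite_embedding G U ha hU hdeg hD hP z d hd hPd
      L A hLU hAU hLd hAd hAne
    refine ⟨ψ, h1, h2, h3, h4, hfinish _ ((hcost ψ L A θ η hLθ hAη h5).trans ?_)⟩
    rw [← hcards]
    nlinarith [mul_nonneg (sub_nonneg.2 hbal.le) (sub_nonneg.2 hηθ)]

end ParentTree

/-- The exponential potential measuring how far the degrees into `U` drop. -/
noncomputable def degreePotential {V : Type*} [Fintype V] (G : SimpleGraph V) [DecidableRel G.Adj]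
    (lam : ℝ) (U : Finset V) : ℝ :=
  ∑ v, Real.exp (-(lam * ((U.filter (G.Adj v)).card / U.card)))

/-- Deleting a set of small total weight from `U` hardly increases the potential. -/
lemma degreePotential_sdiff_le {V : Type*} [Fintype V] [DecidableEq V] (G : SimpleGraph V)
    [DecidableRel G.Adj] {lam b : ℝ} (hlam : 0 < lam) {U Y : Finset V} (hYU : Y ⊆ U)
    (hlt : Y.card < U.card) (hsmall : lam * Y.card ≤ (U \ Y).card)
    (hcost : U.card * ∑ u ∈ Y, ∑ v, (if G.Adj u v then
        Real.exp (-(lam * ((U.filter (G.Adj v)).card / U.card))) else 0) ≤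
      Y.card * (∑ u ∈ U, ∑ v, if G.Adj u v then
        Real.exp (-(lam * ((U.filter (G.Adj v)).card / U.card))) else 0) +
        U.card * (b * degreePotential G lam U)) :
    degreePotential G lam (U \ Y) ≤ degreePotential G lam U *
      Real.exp (lam * b / (U \ Y).card + (lam * Y.card / (U \ Y).card) ^ 2) := by
  set ω : V → ℝ := fun v => Real.exp (-(lam * ((U.filter (G.Adj v)).card / U.card))) with hω
  have hΩ : degreePotential G lam U = ∑ v, ω v := rfl
  have hcard : ((U \ Y).card : ℝ) = U.card - Y.card := by
    rw [Finset.card_sdiff_of_subset hYU, Nat.cast_sub hlt.le]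
  have hswap : ∀ Z : Finset V, ∑ u ∈ Z, ∑ v, (if G.Adj u v then ω v else 0) =
      ∑ v, ω v * (Z.filter (G.Adj v)).card := by
    intro Z
    rw [Finset.sum_comm]
    refine Finset.sum_congr rfl fun v _ => ?_
    rw [← Finset.sum_filter, Finset.sum_const, nsmul_eq_mul, mul_comm]
    simp only [G.adj_comm]
  rw [hswap, hswap, hΩ] at hcost
  rw [hΩ]
  set m : ℝ := (U.card : ℝ)
  set m' : ℝ := ((U \ Y).card : ℝ)
  set s : ℝ := (Y.card : ℝ)
  have hs0 : 0 ≤ s := Nat.cast_nonneg _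
  have hm' : 0 < m' := by
    rw [hcard, sub_pos]
    exact Nat.cast_lt.2 hlt
  have hm : 0 < m := by linarith
  let t : V → ℝ := fun v =>
    lam * (m * (Y.filter (G.Adj v)).card - s * (U.filter (G.Adj v)).card) / (m * m')
  have hsplit : ∀ v, Real.exp (-(lam * (((U \ Y).filter (G.Adj v)).card / m'))) =
      ω v * Real.exp (t v) := by
    intro v
    rw [hω, ← Real.exp_add]
    congr 1
    have hc : (((U \ Y).filter (G.Adj v)).card : ℝ) =
        (U.filter (G.Adj v)).card - (Y.filter (G.Adj v)).card := by
      have hf : (U \ Y).filter (G.Adj v) = U.filter (G.Adj v) \ Y.filter (G.Adj v) := by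
        ext u
        simp only [Finset.mem_filter, Finset.mem_sdiff]
        tauto
      rw [hf, Finset.card_sdiff_of_subset
        (Finset.filter_subset_filter _ hYU), Nat.cast_sub (Finset.card_le_card
        (Finset.filter_subset_filter _ hYU))]
    rw [hc]
    simp only [t]
    field_simp
    rw [hcard]
    ring
  have htle : ∀ v, |t v| ≤ lam * s / m' := by
    intro v
    have h1 : ((Y.filter (G.Adj v)).card : ℝ) ≤ s := Nat.cast_le.2 (Finset.card_filter_le _ _)
    have h2 : ((U.filter (G.Adj v)).card : ℝ) ≤ m := Nat.cast_le.2 (Finset.card_filter_le _ _)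
    have h3 : |m * ((Y.filter (G.Adj v)).card : ℝ) - s * (U.filter (G.Adj v)).card| ≤ m * s := by
      rw [abs_le]
      have h4 : m * ((Y.filter (G.Adj v)).card : ℝ) ≤ m * s := by gcongr
      have h5 : s * ((U.filter (G.Adj v)).card : ℝ) ≤ s * m := by gcongr
      constructor <;> nlinarith [
        mul_nonneg hm.le (Nat.cast_nonneg (α := ℝ) (Y.filter (G.Adj v)).card),
        mul_nonneg hs0 (Nat.cast_nonneg (α := ℝ) (U.filter (G.Adj v)).card)]
    simp only [t]
    rw [abs_div, abs_mul, abs_of_pos hlam, abs_of_pos (mul_pos hm hm'), div_le_div_iff₀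
      (mul_pos hm hm') hm']
    have := mul_le_mul_of_nonneg_left h3 (mul_pos hlam hm').le
    nlinarith
  have hle1 : lam * s / m' ≤ 1 := (div_le_one hm').2 hsmall
  have hexp : ∀ v, Real.exp (t v) ≤ 1 + t v + (lam * s / m') ^ 2 := by
    intro v
    have h1 := Real.abs_exp_sub_one_sub_id_le ((htle v).trans hle1)
    have h2 : t v ^ 2 ≤ (lam * s / m') ^ 2 := sq_le_sq' (abs_le.1 (htle v)).1 (abs_le.1 (htle v)).2
    linarith [(abs_le.1 h1).2]
  have hlin : ∑ v, ω v * t v ≤ lam * b / m' * ∑ v, ω v := by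
    have h1 : ∑ v, ω v * t v = lam / (m * m') * (m * ∑ v, ω v * (Y.filter (G.Adj v)).card -
        s * ∑ v, ω v * (U.filter (G.Adj v)).card) := by
      rw [Finset.mul_sum, Finset.mul_sum, ← Finset.sum_sub_distrib, Finset.mul_sum]
      refine Finset.sum_congr rfl fun v _ => ?_
      simp only [t]
      ring
    rw [h1]
    calc _ ≤ lam / (m * m') * (m * (b * ∑ v, ω v)) := by
          gcongr
          linarith
      _ = _ := by field_simp
  calc degreePotential G lam (U \ Y) = ∑ v, ω v * Real.exp (t v) :=
        Finset.sum_congr rfl fun v _ => hsplit v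
    _ ≤ ∑ v, ω v * (1 + t v + (lam * s / m') ^ 2) :=
        Finset.sum_le_sum fun v _ => mul_le_mul_of_nonneg_left (hexp v) (Real.exp_pos _).le
    _ = ∑ v, ω v + ∑ v, ω v * t v + (lam * s / m') ^ 2 * ∑ v, ω v := by
        rw [Finset.mul_sum, ← Finset.sum_add_distrib, ← Finset.sum_add_distrib]
        exact Finset.sum_congr rfl fun v _ => by ring
    _ ≤ (∑ v, ω v) * (lam * b / m' + (lam * s / m') ^ 2 + 1) := by linarith
    _ ≤ _ := mul_le_mul_of_nonneg_left (Real.add_one_le_exp _)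
        (Finset.sum_nonneg fun v _ => (Real.exp_pos _).le)

namespace ParentTree
variable {X V : Type*} [DecidableEq X] {τ : ParentTree X}

/-- Gluing an embedding of an attached subtree to a given embedding. -/
lemma IsEmb.piecewise [DecidableEq V] {G : SimpleGraph V} {D P : Finset X} {r : X} {φ ψ : X → V}
    (hD : τ.IsClosed D) (hφ : τ.IsEmb G D φ) (hP : τ.Attached D P r) (hinj : Set.InjOn ψ P)
    (hdisj : ∀ x ∈ P, ψ x ∉ D.image φ) (hr : G.Adj (φ (τ.par r)) (ψ r))
    (hadj : ∀ x ∈ P, x ≠ r → G.Adj (ψ (τ.par x)) (ψ x)) :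
    τ.IsEmb G (D ∪ P) (D.piecewise φ ψ) := by
  have hPD : ∀ x ∈ P, x ∉ D := fun x hx h => Finset.disjoint_left.1 hP.disj h hx
  constructor
  · intro x hx y hy hxy
    rw [Finset.mem_coe, Finset.mem_union] at hx hy
    rcases hx with hx | hx <;> rcases hy with hy | hy
    · rw [D.piecewise_eq_of_mem _ _ hx, D.piecewise_eq_of_mem _ _ hy] at hxy
      exact hφ.inj hx hy hxy
    · rw [D.piecewise_eq_of_mem _ _ hx, D.piecewise_eq_of_notMem _ _ (hPD y hy)] at hxy
      exact absurd (hxy ▸ Finset.mem_image_of_mem φ hx) (hdisj y hy)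
    · rw [D.piecewise_eq_of_notMem _ _ (hPD x hx), D.piecewise_eq_of_mem _ _ hy] at hxy
      exact absurd (hxy ▸ Finset.mem_image_of_mem φ hy) (hdisj x hx)
    · rw [D.piecewise_eq_of_notMem _ _ (hPD x hx), D.piecewise_eq_of_notMem _ _ (hPD y hy)] at hxy
      exact hinj hx hy hxy
  · intro x hx hxr
    rcases Finset.mem_union.1 hx with hx | hx
    · rw [D.piecewise_eq_of_mem _ _ hx, D.piecewise_eq_of_mem _ _ (hD.par_mem x hx)]
      exact hφ.adj x hx hxr
    · rw [D.piecewise_eq_of_notMem _ _ (hPD x hx)]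
      by_cases h : x = r
      · subst h
        rwa [D.piecewise_eq_of_mem _ _ hP.par_root_mem]
      · rw [D.piecewise_eq_of_notMem _ _ (hPD _ (hP.par_mem x hx h))]
        exact hadj x hx h

/-- Extending an embedding by a small subtree while controlling the potential. -/
lemma IsEmb.exists_extension [Fintype V] [DecidableEq V] {G : SimpleGraph V} [DecidableRel G.Adj]
    {D P : Finset X} {r : X} {φ : X → V} (hD : τ.IsClosed D) (hφ : τ.IsEmb G D φ)
    (hP : τ.Attached D P r) {U : Finset V} (hUdef : U = Finset.univ \ D.image φ)
    {a ε lam : ℝ} (ha : 0 < a) (hε : 0 < ε) (hε2 : ε ≤ 1 / 2) (hlam : 0 < lam)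
    (hdeg : ∀ v, (1 / 2 + a) * U.card ≤ (U.filter (G.Adj v)).card) (d : ℕ)
    (hd : (P.card : ℝ) ≤ 2 * a * d) (hPd : P.card ≤ d) (hUd : 2 * d < ε * a * U.card)
    (hPU : P.card < U.card) (hsmall : lam * P.card + P.card ≤ U.card) :
    ∃ φ' : X → V, Set.EqOn φ' φ D ∧ τ.IsEmb G (D ∪ P) φ' ∧
      degreePotential G lam (Finset.univ \ (D ∪ P).image φ') ≤ degreePotential G lam U *
        Real.exp (lam * (1 + ε * P.card) / (U.card - P.card) +
          (lam * P.card / (U.card - P.card)) ^ 2) := by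
  set ω : V → ℝ := fun v => Real.exp (-(lam * ((U.filter (G.Adj v)).card / U.card))) with hω
  have hΩ : degreePotential G lam U = ∑ v, ω v := rfl
  have hΩpos : 0 < degreePotential G lam U :=
    Finset.sum_pos (fun v _ => Real.exp_pos _) ⟨φ r, Finset.mem_univ _⟩
  have hω0 : ∀ u v, 0 ≤ (if G.Adj u v then ω v else 0) := by
    intro u v
    split_ifs
    · exact (Real.exp_pos _).le
    · exact le_rfl
  obtain ⟨ψ, hinj, hψU, hzr, hadj, hcost⟩ := exists_cheap_embedding G U ha hε hε2 hdeg
    (fun u => (∑ v, if G.Adj u v then ω v else 0) / degreePotential G lam U)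
    (fun u => div_nonneg (Finset.sum_nonneg fun v _ => hω0 u v) hΩpos.le)
    (fun u => (div_le_one hΩpos).2 (Finset.sum_le_sum fun v _ => by
      split_ifs
      · exact le_rfl
      · exact (Real.exp_pos _).le)) hD hP (φ (τ.par r)) d hd hPd hUd
  have hdisj : ∀ x ∈ P, ψ x ∉ D.image φ := fun x hx => by
    have := hψU x hx
    rw [hUdef] at this
    exact (Finset.mem_sdiff.1 this).2
  refine ⟨D.piecewise φ ψ, fun x hx => D.piecewise_eq_of_mem _ _ hx,
    hφ.piecewise hD hP hinj hdisj hzr hadj, ?_⟩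
  have himage : (D ∪ P).image (D.piecewise φ ψ) = D.image φ ∪ P.image ψ := by
    rw [Finset.image_union]
    congr 1
    · exact Finset.image_congr fun x hx => D.piecewise_eq_of_mem _ _ hx
    · exact Finset.image_congr fun x hx => D.piecewise_eq_of_notMem _ _ fun h =>
        Finset.disjoint_left.1 hP.disj h hx
  have hUnew : Finset.univ \ (D ∪ P).image (D.piecewise φ ψ) = U \ P.image ψ := by
    rw [himage, hUdef, sdiff_sdiff_left, Finset.sup_eq_union]
  have hYcard : (P.image ψ).card = P.card := Finset.card_image_of_injOn hinj
  have hYU : P.image ψ ⊆ U := Finset.image_subset_iff.2 hψU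
  have hcard : ((U \ P.image ψ).card : ℝ) = U.card - P.card := by
    rw [Finset.card_sdiff_of_subset hYU, hYcard, Nat.cast_sub hPU.le]
  have key := degreePotential_sdiff_le G (b := 1 + ε * P.card) hlam hYU (by omega)
    (by rw [hYcard, hcard]; linarith) (by
      rw [Finset.sum_image hinj, hYcard]
      simp only [← Finset.sum_div] at hcost
      have h1 := mul_le_mul_of_nonneg_right hcost hΩpos.le
      have h2 : ∀ c : ℝ, c / degreePotential G lam U * degreePotential G lam U = c :=
        fun c => div_mul_cancel₀ _ hΩpos.ne'
      rw [add_mul, mul_assoc, mul_assoc, mul_assoc, h2, h2] at h1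
      exact h1)
  rw [hYcard, hcard] at key
  rw [hUnew]
  exact key

/-- Embedding a tree by successively attaching subtrees of bounded size while at least `m₀`
vertices remain free. -/
lemma Build.exists_isEmb [Fintype V] [DecidableEq V] {G : SimpleGraph V} [DecidableRel G.Adj]
    {K S : ℕ} {D₀ D : Finset X} {φ₀ : X → V} (hB : τ.Build K S D₀ D) (hD₀ : τ.IsClosed D₀)
    (hφ₀ : τ.IsEmb G D₀ φ₀) {a₀ a ε lam m₀ κ : ℝ} (ha : 0 < a) (hε : 0 < ε) (hε2 : ε ≤ 1 / 2)
    (hlam : 0 < lam) (hm₀ : 0 < m₀) (hK : 1 ≤ ε * K) (d : ℕ) (hd : (S : ℝ) ≤ 2 * a * d)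
    (hSd : S ≤ d) (hm₀d : 2 * d < ε * a * m₀) (hsmall : lam * S ≤ m₀)
    (hκ : κ = lam * (2 * ε) / m₀ + lam ^ 2 * S / m₀ ^ 2)
    (hpot : Fintype.card V * Real.exp (-(lam * (1 / 2 + a₀))) * Real.exp (κ * Fintype.card V) ≤
      Real.exp (-(lam * (1 / 2 + a))))
    (hdeg : ∀ v, (1 / 2 + a₀) * (Finset.univ \ D₀.image φ₀).card ≤
      (((Finset.univ \ D₀.image φ₀).filter (G.Adj v)).card : ℝ))
    (hDcard : D.card + m₀ ≤ Fintype.card V) :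
    ∃ φ : X → V, Set.EqOn φ φ₀ D₀ ∧ τ.IsEmb G D φ ∧
      degreePotential G lam (Finset.univ \ D.image φ) ≤
        Fintype.card V * Real.exp (-(lam * (1 / 2 + a₀))) * Real.exp (κ * D.card) := by
  have hκ0 : 0 ≤ κ := by rw [hκ]; positivity
  have hUcard : ∀ {D' : Finset X} {φ : X → V}, τ.IsEmb G D' φ →
      ((Finset.univ \ D'.image φ).card : ℝ) = Fintype.card V - D'.card := by
    intro D' φ h
    rw [← Finset.compl_eq_univ_sdiff, Finset.card_compl, Finset.card_image_of_injOn h.inj,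
      Nat.cast_sub]
    rw [← Finset.card_image_of_injOn h.inj]
    exact Finset.card_le_univ _
  induction hB with
  | refl =>
    refine ⟨φ₀, fun _ _ => rfl, hφ₀, ?_⟩
    have hpos : (0 : ℝ) < (Finset.univ \ D₀.image φ₀).card := by
      rw [hUcard hφ₀]; linarith
    calc degreePotential G lam (Finset.univ \ D₀.image φ₀)
        ≤ ∑ v : V, Real.exp (-(lam * (1 / 2 + a₀))) := by
          refine Finset.sum_le_sum fun v _ => Real.exp_le_exp.2 (neg_le_neg ?_)
          gcongr
          rw [le_div_iff₀ hpos]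
          exact hdeg v
      _ = Fintype.card V * Real.exp (-(lam * (1 / 2 + a₀))) * 1 := by simp
      _ ≤ _ := by
          gcongr
          exact Real.one_le_exp (by positivity)
  | @step D P r hB hP hKP hPS ih =>
    rw [Finset.card_union_of_disjoint hP.disj, Nat.cast_add] at hDcard
    obtain ⟨φ, heq, hφ, hΦ⟩ := ih (by linarith [Nat.cast_nonneg (α := ℝ) P.card])
    have hP0 : (0 : ℝ) ≤ P.card := Nat.cast_nonneg _
    have hPS' : (P.card : ℝ) ≤ S := Nat.cast_le.2 hPS
    have hKP' : (K : ℝ) ≤ P.card := Nat.cast_le.2 hKP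
    have hU := hUcard hφ
    have hUpos : (0 : ℝ) < (Finset.univ \ D.image φ).card := by linarith
    have hmin : ∀ v, (1 / 2 + a) * ((Finset.univ \ D.image φ).card : ℝ) ≤
        (((Finset.univ \ D.image φ).filter (G.Adj v)).card : ℝ) := by
      intro v
      rw [← le_div_iff₀ hUpos]
      have h1 : Real.exp (-(lam * (((Finset.univ \ D.image φ).filter (G.Adj v)).card /
          (Finset.univ \ D.image φ).card))) ≤ Real.exp (-(lam * (1 / 2 + a))) := by
        refine le_trans ?_ ((hΦ.trans ?_).trans hpot)
        · exact Finset.single_le_sum (f := fun v => Real.exp (-(lam *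
            (((Finset.univ \ D.image φ).filter (G.Adj v)).card /
              (Finset.univ \ D.image φ).card)))) (fun v _ => (Real.exp_pos _).le)
            (Finset.mem_univ v)
        · gcongr
          have : (D.card : ℝ) ≤ Fintype.card V := by linarith
          exact_mod_cast this
      have h2 := neg_le_neg_iff.1 (Real.exp_le_exp.1 h1)
      exact le_of_mul_le_mul_left h2 hlam
    obtain ⟨φ', heq', hφ', hΦ'⟩ := hφ.exists_extension (hB.isClosed hD₀) hP rfl ha hε hε2 hlam
      hmin d (hPS'.trans hd) (hPS.trans hSd)
      (hm₀d.trans_le (by rw [hU]; gcongr; linarith))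
      (by
        have : (P.card : ℝ) < (Finset.univ \ D.image φ).card := by rw [hU]; linarith
        exact_mod_cast this)
      (by
        rw [hU]
        have : lam * P.card ≤ lam * S := by gcongr
        linarith)
    refine ⟨φ', fun x hx => (heq' (hB.subset hx)).trans (heq hx), hφ', hΦ'.trans ?_⟩
    have hm' : m₀ ≤ ((Finset.univ \ D.image φ).card : ℝ) - P.card := by rw [hU]; linarith
    have hexp : lam * (1 + ε * P.card) / (((Finset.univ \ D.image φ).card : ℝ) - P.card) +
        (lam * P.card / (((Finset.univ \ D.image φ).card : ℝ) - P.card)) ^ 2 ≤ κ * P.card := by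
      have h1 : 1 + ε * P.card ≤ 2 * ε * P.card := by
        have : ε * K ≤ ε * P.card := by gcongr
        linarith
      generalize ((Finset.univ \ D.image φ).card : ℝ) - P.card = m' at hm'
      have hm'0 : 0 < m' := hm₀.trans_le hm'
      calc _ ≤ lam * (2 * ε * P.card) / m₀ + (lam * P.card / m₀) ^ 2 := by gcongr
        _ = lam * (2 * ε) / m₀ * P.card + lam ^ 2 * P.card / m₀ ^ 2 * P.card := by ring
        _ ≤ lam * (2 * ε) / m₀ * P.card + lam ^ 2 * S / m₀ ^ 2 * P.card := by gcongr
        _ = κ * P.card := by rw [hκ]; ring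
    calc _ ≤ Fintype.card V * Real.exp (-(lam * (1 / 2 + a₀))) * Real.exp (κ * D.card) *
          Real.exp (κ * P.card) :=
          mul_le_mul hΦ (Real.exp_le_exp.2 hexp) (Real.exp_pos _).le (by positivity)
      _ = _ := by
          rw [Finset.card_union_of_disjoint hP.disj, Nat.cast_add, mul_add κ, Real.exp_add,
            mul_assoc _ (Real.exp (κ * D.card))]

end ParentTree

/-- The sum over all tests of the products over all blocks is a pessimistic estimator: fixing one
more coordinate can be done without increasing it. -/
lemma exists_update_estimator_le {ι X V : Type*} [Fintype ι] [DecidableEq X]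
    (Q : Finset X) (s : X → Finset X)
    (hs : ∀ w ∈ Q, ∀ w' ∈ Q, w ≠ w' → Disjoint (s w) (s w')) (g : ι → X → ℝ)
    (hg0 : ∀ i x, 0 ≤ g i x) (hg1 : ∀ i x, g i x ≤ 1) {x : X} {c : ℝ} (hx : ∀ i, g i x = c)
    (F : Finset V) (hF : F.Nonempty) (p : ι → V → Prop) [∀ i, DecidablePred (p i)]
    (hp : ∀ i, c * F.card ≤ (F.filter (p i)).card) :
    ∃ u ∈ F, ∑ i, ∏ w ∈ Q,
        (1 - 1 / 2 * ∏ y ∈ s w, Function.update (g i) x (if p i u then 1 else 0) y) ≤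
      ∑ i, ∏ w ∈ Q, (1 - 1 / 2 * ∏ y ∈ s w, g i y) := by
  have hout : ∀ (i : ι) (a : ℝ), ∀ w, x ∉ s w →
      ∏ y ∈ s w, Function.update (g i) x a y = ∏ y ∈ s w, g i y := by
    intro i a w hw
    refine Finset.prod_congr rfl fun y hy => Function.update_of_ne ?_ _ _
    rintro rfl
    exact hw hy
  by_cases hQ : ∃ w₀ ∈ Q, x ∈ s w₀
  · obtain ⟨w₀, hw₀, hxw₀⟩ := hQ
    set A : ι → ℝ := fun i => ∏ w ∈ Q.erase w₀, (1 - 1 / 2 * ∏ y ∈ s w, g i y)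
    set B : ι → ℝ := fun i => ∏ y ∈ (s w₀).erase x, g i y
    have hA : ∀ i, 0 ≤ A i := fun i => Finset.prod_nonneg fun w _ => by
      have : ∏ y ∈ s w, g i y ≤ 1 := Finset.prod_le_one (fun y _ => hg0 i y) fun y _ => hg1 i y
      linarith
    have hB : ∀ i, 0 ≤ B i := fun i => Finset.prod_nonneg fun y _ => hg0 i y
    have hval : ∀ i a, ∏ w ∈ Q, (1 - 1 / 2 * ∏ y ∈ s w, Function.update (g i) x a y) =
        A i - 1 / 2 * (A i * B i * a) := by
      intro i a
      rw [← Finset.mul_prod_erase Q _ hw₀, ← Finset.mul_prod_erase (s w₀) _ hxw₀,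
        Function.update_self]
      have h1 : ∏ y ∈ (s w₀).erase x, Function.update (g i) x a y = B i :=
        Finset.prod_congr rfl fun y hy => Function.update_of_ne (Finset.ne_of_mem_erase hy) _ _
      have h2 : ∏ w ∈ Q.erase w₀, (1 - 1 / 2 * ∏ y ∈ s w, Function.update (g i) x a y) = A i := by
        refine Finset.prod_congr rfl fun w hw => ?_
        rw [hout i a w]
        exact Finset.disjoint_left.1
          (hs w₀ hw₀ w (Finset.mem_of_mem_erase hw) (Finset.ne_of_mem_erase hw).symm) hxw₀
      rw [h1, h2]
      ring
    have hval' : ∀ i, ∏ w ∈ Q, (1 - 1 / 2 * ∏ y ∈ s w, g i y) =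
        A i - 1 / 2 * (A i * B i * c) := by
      intro i
      rw [← hval i c, ← hx i, Function.update_eq_self]
    simp only [hval, hval', Finset.sum_sub_distrib, ← Finset.mul_sum]
    suffices h : ∃ u ∈ F, ∑ i, A i * B i * c ≤ ∑ i, A i * B i * (if p i u then 1 else 0) by
      obtain ⟨u, hu, h⟩ := h
      exact ⟨u, hu, by linarith⟩
    refine Finset.exists_le_of_sum_le hF ?_
    rw [Finset.sum_const, nsmul_eq_mul, Finset.mul_sum, Finset.sum_comm]
    refine Finset.sum_le_sum fun i _ => ?_
    rw [← Finset.mul_sum, Finset.sum_boole]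
    have := mul_le_mul_of_nonneg_left (hp i) (mul_nonneg (hA i) (hB i))
    linarith
  · push Not at hQ
    obtain ⟨u, hu⟩ := hF
    refine ⟨u, hu, Finset.sum_le_sum fun i _ => le_of_eq ?_⟩
    exact Finset.prod_congr rfl fun w hw => by rw [hout i _ w (hQ w hw)]

namespace ParentTree
variable {X V : Type*} [DecidableEq X] {τ : ParentTree X}

/-- Every closed set is obtained from a smaller one by adding vertices one by one, each of them a
child of an earlier vertex. -/
lemma IsClosed.induction_on {D₀ : Finset X} (h₀ : τ.IsClosed D₀) {p : Finset X → Prop}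
    (base : p D₀) (step : ∀ D x, τ.IsClosed D → D₀ ⊆ D → x ∉ D → τ.par x ∈ D → p D →
      p (insert x D)) {D : Finset X} (hD : τ.IsClosed D) (hsub : D₀ ⊆ D) : p D := by
  induction h : (D \ D₀).card generalizing D with
  | zero =>
    have : D = D₀ := (Finset.sdiff_eq_empty_iff_subset.1 (Finset.card_eq_zero.1 h)).antisymm hsub
    exact this ▸ base
  | succ k ih =>
    obtain ⟨x, hx, hmax⟩ := Finset.exists_max_image (D \ D₀) τ.depth (Finset.card_pos.1 (by omega))
    obtain ⟨hxD, hxD₀⟩ := Finset.mem_sdiff.1 hx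
    have hxr : x ≠ τ.root := by
      rintro rfl
      exact hxD₀ h₀.root_mem
    have hsub' : D₀ ⊆ D.erase x := fun y hy =>
      Finset.mem_erase.2 ⟨fun hyx => hxD₀ (hyx ▸ hy), hsub hy⟩
    have hclosed : τ.IsClosed (D.erase x) := by
      refine ⟨hsub' h₀.root_mem, fun y hy => Finset.mem_erase.2 ⟨fun hyx => ?_,
        hD.par_mem y (Finset.mem_of_mem_erase hy)⟩⟩
      by_cases hyD : y ∈ D₀
      · exact hxD₀ (hyx ▸ h₀.par_mem y hyD)
      · have h1 := hmax y (Finset.mem_sdiff.2 ⟨Finset.mem_of_mem_erase hy, hyD⟩)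
        have h2 : y ≠ τ.root := by
          rintro rfl
          exact hyD h₀.root_mem
        have h3 := depth_par_lt h2
        rw [hyx] at h3
        omega
    have hcard : (D.erase x \ D₀).card = k := by
      rw [Finset.erase_sdiff_comm, Finset.card_erase_of_mem hx, h, Nat.add_sub_cancel]
    have := step (D.erase x) x hclosed hsub' (Finset.notMem_erase x D)
      (Finset.mem_erase.2 ⟨par_ne hxr, hD.par_mem x hxD⟩) (ih hclosed hsub' hcard)
    rwa [Finset.insert_erase hxD] at this

variable (τ) in
/-- A vertex together with its neighbours in the tree. -/
def star [Fintype X] (w : X) : Finset X := insert (τ.par w) (insert w (τ.children w))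

lemma self_mem_star [Fintype X] (w : X) : w ∈ τ.star w := by simp [star]

lemma card_star_le [Fintype X] {Δ : ℕ} (hΔ : ∀ x, (τ.children x).card ≤ Δ) (w : X) :
    (τ.star w).card ≤ Δ + 2 := by
  have h1 := Finset.card_insert_le (τ.par w) (insert w (τ.children w))
  have h2 := Finset.card_insert_le w (τ.children w)
  have h3 := hΔ w
  unfold star
  omega

variable (τ) in
/-- A set of vertices of `D` with pairwise disjoint stars, all of them contained in `D` and
avoiding the root. -/
structure IsPool [Fintype X] (D Q : Finset X) : Prop where
  subset : ∀ w ∈ Q, τ.star w ⊆ D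
  root_notMem : ∀ w ∈ Q, τ.root ∉ τ.star w
  disj : ∀ w ∈ Q, ∀ w' ∈ Q, w ≠ w' → Disjoint (τ.star w) (τ.star w')

variable (τ) in
/-- The vertices of `Q` whose image is adjacent to `y` and the images of whose tree neighbours are
adjacent to `z`. -/
noncomputable def absorbers [Fintype X] (G : SimpleGraph V) (φ : X → V) (Q : Finset X) (y z : V) :
    Finset X :=
  open Classical in
  Q.filter fun w => G.Adj y (φ w) ∧ ∀ x ∈ τ.star w, x ≠ w → G.Adj z (φ x)

lemma mem_absorbers [Fintype X] {G : SimpleGraph V} {φ : X → V} {Q : Finset X} {y z : V} {w : X} :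
    w ∈ τ.absorbers G φ Q y z ↔
      w ∈ Q ∧ G.Adj y (φ w) ∧ ∀ x ∈ τ.star w, x ≠ w → G.Adj z (φ x) := by
  simp [absorbers]

/-- Extending an embedding by one vertex. -/
lemma IsEmb.update {G : SimpleGraph V} {D : Finset X} {φ : X → V} (hD : τ.IsClosed D)
    (hφ : τ.IsEmb G D φ) {x : X} (hx : x ∉ D) (hpar : τ.par x ∈ D) {u : V}
    (hadj : G.Adj (φ (τ.par x)) u) (hu : ∀ y ∈ D, φ y ≠ u) :
    τ.IsEmb G (insert x D) (Function.update φ x u) := by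
  have hne : ∀ y ∈ D, y ≠ x := fun y hy h => hx (h ▸ hy)
  constructor
  · intro y hy y' hy' h
    rw [Finset.mem_coe, Finset.mem_insert] at hy hy'
    rcases hy with rfl | hy <;> rcases hy' with rfl | hy'
    · rfl
    · rw [Function.update_self, Function.update_of_ne (hne _ hy')] at h
      exact absurd h.symm (hu _ hy')
    · rw [Function.update_self, Function.update_of_ne (hne _ hy)] at h
      exact absurd h (hu _ hy)
    · rw [Function.update_of_ne (hne _ hy), Function.update_of_ne (hne _ hy')] at h
      exact hφ.inj hy hy' h
  · intro y hy hyr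
    rcases Finset.mem_insert.1 hy with rfl | hy
    · rwa [Function.update_self, Function.update_of_ne (hne _ hpar)]
    · rw [Function.update_of_ne (hne _ hy), Function.update_of_ne (hne _ (hD.par_mem y hy))]
      exact hφ.adj y hy hyr

/-- A small subtree can be embedded so that every pair of vertices has many absorbers. -/
lemma exists_absorbing_isEmb [Fintype X] [Fintype V] [DecidableEq V] (G : SimpleGraph V)
    [DecidableRel G.Adj] {α : ℝ} (hα : 0 < α) (hα1 : α ≤ 1)
    (hdeg : ∀ v, (1 / 2 + α) * Fintype.card V ≤ ((Finset.univ.filter (G.Adj v)).card : ℝ))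
    {Δ : ℕ} (hΔ : ∀ x, (τ.children x).card ≤ Δ) {D Q : Finset X} (hD : τ.IsClosed D)
    (hcard : (D.card : ℝ) ≤ α * Fintype.card V) (hQ : τ.IsPool D Q) (v : V) :
    ∃ φ : X → V, φ τ.root = v ∧ τ.IsEmb G D φ ∧ ∀ y z,
      (1 / 2 : ℝ) ^ (τ.absorbers G φ Q y z).card ≤
        Fintype.card V ^ 2 * (1 - 1 / 2 * α ^ (Δ + 2)) ^ Q.card := by
  classical
  have hV : (0 : ℝ) < Fintype.card V := by exact_mod_cast Fintype.card_pos_iff.2 ⟨v⟩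
  let tgt : V × V → X → V := fun i x => if x ∈ Q then i.1 else i.2
  let g : Finset X → (X → V) → V × V → X → ℝ := fun D φ i x =>
    if x ∈ D then (if G.Adj (tgt i x) (φ x) then 1 else 0) else α
  let Ψ : Finset X → (X → V) → ℝ := fun D φ =>
    ∑ i, ∏ w ∈ Q, (1 - 1 / 2 * ∏ x ∈ τ.star w, g D φ i x)
  have hg0 : ∀ D φ i x, 0 ≤ g D φ i x := by
    intro D φ i x
    simp only [g]
    split_ifs <;> simp [hα.le]
  have hg1 : ∀ D φ i x, g D φ i x ≤ 1 := by
    intro D φ i x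
    simp only [g]
    split_ifs <;> simp [hα1]
  have hprod : ∀ D φ i w, ∏ x ∈ τ.star w, g D φ i x ≤ 1 := fun D φ i w =>
    Finset.prod_le_one (fun x _ => hg0 D φ i x) fun x _ => hg1 D φ i x
  have hroot : τ.IsClosed {τ.root} := by
    refine ⟨Finset.mem_singleton_self _, fun x hx => ?_⟩
    rw [Finset.mem_singleton.1 hx, τ.par_root]
    exact Finset.mem_singleton_self _
  have hstart : Ψ {τ.root} (fun _ => v) ≤
      Fintype.card V ^ 2 * (1 - 1 / 2 * α ^ (Δ + 2)) ^ Q.card := by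
    calc Ψ {τ.root} (fun _ => v) ≤ ∑ i : V × V, ∏ w ∈ Q, (1 - 1 / 2 * α ^ (Δ + 2)) := by
          refine Finset.sum_le_sum fun i _ => Finset.prod_le_prod (fun w _ => ?_) fun w hw => ?_
          · linarith [hprod {τ.root} (fun _ => v) i w]
          · have h1 : ∏ x ∈ τ.star w, g {τ.root} (fun _ => v) i x = α ^ (τ.star w).card := by
              rw [← Finset.prod_const]
              refine Finset.prod_congr rfl fun x hx => if_neg fun h => ?_
              exact hQ.root_notMem w hw (Finset.mem_singleton.1 h ▸ hx)
            have h2 := pow_le_pow_of_le_one hα.le hα1 (card_star_le hΔ w)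
            rw [h1]
            linarith
      _ = _ := by
          simp [Fintype.card_prod, sq]
  have hmain : (D.card : ℝ) ≤ α * Fintype.card V → ∃ φ : X → V, φ τ.root = v ∧ τ.IsEmb G D φ ∧
      Ψ D φ ≤ Fintype.card V ^ 2 * (1 - 1 / 2 * α ^ (Δ + 2)) ^ Q.card := by
    refine hroot.induction_on (p := fun D => (D.card : ℝ) ≤ α * Fintype.card V → ∃ φ : X → V,
      φ τ.root = v ∧ τ.IsEmb G D φ ∧
      Ψ D φ ≤ Fintype.card V ^ 2 * (1 - 1 / 2 * α ^ (Δ + 2)) ^ Q.card) ?_ ?_ hD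
      (Finset.singleton_subset_iff.2 hD.root_mem)
    · refine fun _ => ⟨fun _ => v, rfl, ⟨by simp, fun x hx hxr => ?_⟩, hstart⟩
      exact absurd (Finset.mem_singleton.1 hx) hxr
    · intro D x hD hr hx hpar ih hcard
      rw [Finset.card_insert_of_notMem hx, Nat.cast_add, Nat.cast_one] at hcard
      obtain ⟨φ, hφv, hφ, hΨ⟩ := ih (by linarith)
      set F := (Finset.univ.filter (G.Adj (φ (τ.par x)))) \ D.image φ with hF
      have himage : ((D.image φ).card : ℝ) ≤ D.card := Nat.cast_le.2 Finset.card_image_le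
      have hinter : ∀ t, α * F.card ≤ ((F.filter (G.Adj t)).card : ℝ) := by
        intro t
        have h1 := card_filter_inter_ge Finset.univ (G.Adj t) (G.Adj (φ (τ.par x)))
        have h2 : ((Finset.univ.filter (G.Adj (φ (τ.par x)))).filter (G.Adj t)).card ≤
            (F.filter (G.Adj t)).card + (D.image φ).card := by
          refine (Finset.card_le_card (t := F.filter (G.Adj t) ∪ D.image φ) fun u hu => ?_).trans
            (Finset.card_union_le _ _)
          rw [Finset.mem_filter] at hu
          by_cases h : u ∈ D.image φ
          · exact Finset.mem_union_right _ h
          · exact Finset.mem_union_left _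
              (Finset.mem_filter.2 ⟨Finset.mem_sdiff.2 ⟨hu.1, h⟩, hu.2⟩)
        have h2' : (((Finset.univ.filter (G.Adj (φ (τ.par x)))).filter (G.Adj t)).card : ℝ) ≤
            (F.filter (G.Adj t)).card + (D.image φ).card := by exact_mod_cast h2
        have h3 : (F.card : ℝ) ≤ Fintype.card V := Nat.cast_le.2 (Finset.card_le_univ _)
        have h4 : α * F.card ≤ α * Fintype.card V := by gcongr
        have h5 := hdeg t
        have h6 := hdeg (φ (τ.par x))
        rw [Finset.card_univ] at h1
        linarith
      have hFne : F.Nonempty := by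
        rw [Finset.nonempty_iff_ne_empty]
        intro hFe
        have h1 := Finset.card_le_card (Finset.sdiff_eq_empty_iff_subset.1 hFe)
        have h1' : ((Finset.univ.filter (G.Adj (φ (τ.par x)))).card : ℝ) ≤ (D.image φ).card :=
          Nat.cast_le.2 h1
        have h6 := hdeg (φ (τ.par x))
        linarith
      obtain ⟨u, huF, hu⟩ := exists_update_estimator_le Q τ.star hQ.disj (g D φ) (hg0 D φ) (hg1 D φ)
        (x := x) (c := α) (fun i => if_neg hx) F hFne (fun i u => G.Adj (tgt i x) u)
        (fun i => hinter _)
      rw [hF, Finset.mem_sdiff, Finset.mem_filter] at huF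
      refine ⟨Function.update φ x u, ?_, hφ.update hD hx hpar huF.1.2 fun y hy h =>
        huF.2 (h ▸ Finset.mem_image_of_mem φ hy), le_trans (le_of_eq ?_) (hu.trans hΨ)⟩
      · rw [Function.update_of_ne, hφv]
        rintro rfl
        exact hx hD.root_mem
      · refine Finset.sum_congr rfl fun i _ => Finset.prod_congr rfl fun w _ => ?_
        congr 2
        refine Finset.prod_congr rfl fun y _ => ?_
        by_cases hy : y = x
        · subst hy
          simp [g]
        · simp [g, hy, Function.update_of_ne]
  obtain ⟨φ, hφv, hφ, hΨ⟩ := hmain hcard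
  refine ⟨φ, hφv, hφ, fun y z => le_trans ?_ hΨ⟩
  have hnonneg : ∀ i, 0 ≤ ∏ w ∈ Q, (1 - 1 / 2 * ∏ x ∈ τ.star w, g D φ i x) :=
    fun i => Finset.prod_nonneg fun w _ => by linarith [hprod D φ i w]
  refine le_trans ?_ (Finset.single_le_sum (f := fun i => ∏ w ∈ Q,
    (1 - 1 / 2 * ∏ x ∈ τ.star w, g D φ i x)) (fun i _ => hnonneg i) (Finset.mem_univ (y, z)))
  have hsub : τ.absorbers G φ Q y z ⊆ Q := fun w hw => (mem_absorbers.1 hw).1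
  rw [← Finset.prod_const, Finset.prod_subset_one_on_sdiff hsub (g := fun w =>
    if w ∈ τ.absorbers G φ Q y z then (1 / 2 : ℝ) else 1) (f := fun _ => 1 / 2)
    (fun w hw => if_neg (Finset.mem_sdiff.1 hw).2) (fun w hw => (if_pos hw).symm)]
  refine Finset.prod_le_prod (fun w _ => by split_ifs <;> norm_num) fun w hw => ?_
  split_ifs with hwa
  · linarith [hprod D φ (y, z) w]
  · suffices h : ∏ x ∈ τ.star w, g D φ (y, z) x = 0 by rw [h]; norm_num
    have hnot : ¬ ∀ x ∈ τ.star w, G.Adj (tgt (y, z) x) (φ x) := by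
      intro hall
      refine hwa (mem_absorbers.2 ⟨hw, ?_, fun x hx hxw => ?_⟩)
      · simpa [tgt, hw] using hall w (self_mem_star w)
      · have hxQ : x ∉ Q := fun hxQ => Finset.disjoint_left.1
          (hQ.disj w hw x hxQ (Ne.symm hxw)) hx (self_mem_star x)
        simpa [tgt, hxQ] using hall x hx
    push Not at hnot
    obtain ⟨x, hx, hxn⟩ := hnot
    refine Finset.prod_eq_zero hx ?_
    simp only [g]
    rw [if_pos (hQ.subset w hw hx), if_neg hxn]

end ParentTree

namespace ParentTree
variable {X V : Type*} [DecidableEq X] {τ : ParentTree X}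

lemma mem_star_of_mem_star [Fintype X] {w x : X} (hw : w ≠ τ.root) (hx : x ∈ τ.star w) :
    w ∈ τ.star x := by
  simp only [star, Finset.mem_insert, mem_children] at hx ⊢
  rcases hx with rfl | rfl | ⟨_, rfl⟩ <;> simp [hw]

/-- A closed set with few vertices hanging from it contains a large pool. -/
lemma IsClosed.exists_isPool [Fintype X] {Δ : ℕ} (hΔ : ∀ x, (τ.children x).card ≤ Δ)
    {D : Finset X} (hD : τ.IsClosed D) :
    ∃ Q, τ.IsPool D Q ∧ D.card ≤ Q.card * (Δ + 2) ^ 2 +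
      ((Finset.univ.filter fun x => x ∉ D ∧ τ.par x ∈ D).card + (Δ + 1)) := by
  set good := D.filter fun w => w ≠ τ.root ∧ τ.par w ≠ τ.root ∧ τ.children w ⊆ D with hgood
  obtain ⟨Q, hQ, hmax⟩ := Finset.exists_max_image (good.powerset.filter fun Q =>
    ∀ w ∈ Q, ∀ w' ∈ Q, w ≠ w' → Disjoint (τ.star w) (τ.star w')) Finset.card ⟨∅, by simp⟩
  rw [Finset.mem_filter, Finset.mem_powerset] at hQ
  obtain ⟨hQgood, hQdisj⟩ := hQ
  have hgoodD : ∀ w ∈ good, w ∈ D ∧ w ≠ τ.root ∧ τ.par w ≠ τ.root ∧ τ.children w ⊆ D :=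
    fun w hw => Finset.mem_filter.1 hw
  refine ⟨Q, ⟨fun w hw => ?_, fun w hw h => ?_, hQdisj⟩, ?_⟩
  · obtain ⟨h1, -, -, h2⟩ := hgoodD w (hQgood hw)
    exact Finset.insert_subset (hD.par_mem w h1) (Finset.insert_subset h1 h2)
  · obtain ⟨-, h1, h2, -⟩ := hgoodD w (hQgood hw)
    simp only [star, Finset.mem_insert, mem_children] at h
    rcases h with h | h | h
    · exact h2 h.symm
    · exact h1 h.symm
    · exact h.1 rfl
  have hcover : good ⊆ Q.biUnion fun w => (τ.star w).biUnion τ.star := by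
    intro u hu
    have hmeet : ∃ w ∈ Q, ¬ Disjoint (τ.star w) (τ.star u) := by
      by_contra! hno
      have huQ : u ∉ Q := fun h =>
        Finset.disjoint_left.1 (hno u h) (self_mem_star u) (self_mem_star u)
      have := hmax (insert u Q) (by
        rw [Finset.mem_filter, Finset.mem_powerset]
        refine ⟨Finset.insert_subset hu hQgood, fun w hw w' hw' hne => ?_⟩
        rcases Finset.mem_insert.1 hw with rfl | hwQ <;>
          rcases Finset.mem_insert.1 hw' with rfl | hwQ'
        · exact absurd rfl hne
        · exact (hno w' hwQ').symm
        · exact hno w hwQ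
        · exact hQdisj w hwQ w' hwQ' hne)
      rw [Finset.card_insert_of_notMem huQ] at this
      omega
    obtain ⟨w, hw, hmeet⟩ := hmeet
    obtain ⟨x, hxw, hxu⟩ := Finset.not_disjoint_iff.1 hmeet
    exact Finset.mem_biUnion.2 ⟨w, hw, Finset.mem_biUnion.2
      ⟨x, hxw, mem_star_of_mem_star (hgoodD u hu).2.1 hxu⟩⟩
  have hgoodcard : good.card ≤ Q.card * (Δ + 2) ^ 2 := by
    refine (Finset.card_le_card hcover).trans (Finset.card_biUnion_le_card_mul _ _ _ fun w _ => ?_)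
    rw [sq]
    exact (Finset.card_biUnion_le_card_mul _ _ _ fun x _ => card_star_le hΔ x).trans
      (Nat.mul_le_mul_right _ (card_star_le hΔ w))
  set H := Finset.univ.filter fun x => x ∉ D ∧ τ.par x ∈ D with hH
  have hsub : D ⊆ good ∪ (H.image τ.par ∪ insert τ.root (τ.children τ.root)) := by
    intro w hw
    by_cases h1 : w = τ.root
    · simp [h1]
    by_cases h2 : τ.par w = τ.root
    · simp [mem_children, h1, h2]
    by_cases h3 : τ.children w ⊆ D
    · exact Finset.mem_union_left _ (Finset.mem_filter.2 ⟨hw, h1, h2, h3⟩)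
    · obtain ⟨x, hx, hxD⟩ := Finset.not_subset.1 h3
      have hxp := (mem_children.1 hx).2
      refine Finset.mem_union_right _ (Finset.mem_union_left _ (Finset.mem_image.2 ⟨x, ?_, hxp⟩))
      rw [hH, Finset.mem_filter, hxp]
      exact ⟨Finset.mem_univ _, hxD, hw⟩
  have h1 := Finset.card_le_card hsub
  have h2 := Finset.card_union_le good (H.image τ.par ∪ insert τ.root (τ.children τ.root))
  have h3 := Finset.card_union_le (H.image τ.par) (insert τ.root (τ.children τ.root))
  have h4 : (H.image τ.par).card ≤ H.card := Finset.card_image_le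
  have h5 := Finset.card_insert_le τ.root (τ.children τ.root)
  have h6 := hΔ τ.root
  omega

/-- Moving an absorber `w` to a free vertex `z` and using its old image for a new vertex `x`. -/
lemma IsEmb.absorb [Fintype X] {G : SimpleGraph V} {D Q : Finset X} {φ : X → V}
    (hD : τ.IsClosed D) (hφ : τ.IsEmb G D φ) (hQ : τ.IsPool D Q) {x w : X} {z : V} (hx : x ∉ D)
    (hpar : τ.par x ∈ D) (hz : ∀ y ∈ D, φ y ≠ z)
    (hw : w ∈ τ.absorbers G φ Q (φ (τ.par x)) z) :
    τ.IsEmb G (insert x D) (Function.update (Function.update φ w z) x (φ w)) := by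
  obtain ⟨hwQ, hwx, hwz⟩ := mem_absorbers.1 hw
  have hstar := hQ.subset w hwQ
  have hwD : w ∈ D := hstar (self_mem_star w)
  have hwr : w ≠ τ.root := by
    rintro rfl
    exact hQ.root_notMem _ hwQ (self_mem_star _)
  have hxr : x ≠ τ.root := by
    rintro rfl
    exact hx hD.root_mem
  have hparw : τ.par w ∈ τ.star w := by simp [star]
  have hchild : ∀ y, y ≠ τ.root → τ.par y = w → y ∈ τ.star w := by
    intro y hy hyw
    simp [star, mem_children, hy, hyw]
  have hparx : τ.par x ≠ w := fun h => hx (hstar (hchild x hxr h))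
  have hmove : τ.IsEmb G D (Function.update φ w z) := by
    constructor
    · intro y hy y' hy' h
      by_cases h1 : y = w <;> by_cases h2 : y' = w
      · rw [h1, h2]
      · rw [h1, Function.update_self, Function.update_of_ne h2] at h
        exact absurd h.symm (hz _ hy')
      · rw [h2, Function.update_self, Function.update_of_ne h1] at h
        exact absurd h (hz _ hy)
      · rw [Function.update_of_ne h1, Function.update_of_ne h2] at h
        exact hφ.inj hy hy' h
    · intro y hy hyr
      by_cases h1 : y = w
      · subst h1
        rw [Function.update_self, Function.update_of_ne (par_ne hyr)]
        exact (hwz _ hparw (par_ne hyr)).symm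
      · rw [Function.update_of_ne h1]
        by_cases h2 : τ.par y = w
        · rw [h2, Function.update_self]
          exact hwz y (hchild y hyr h2) h1
        · rw [Function.update_of_ne h2]
          exact hφ.adj y hy hyr
  refine hmove.update hD hx hpar ?_ fun y hy => ?_
  · rwa [Function.update_of_ne hparx]
  · by_cases h : y = w
    · rw [h, Function.update_self]
      exact (hz w hwD).symm
    · rw [Function.update_of_ne h]
      exact fun hyw => h (hφ.inj hy hwD hyw)

/-- If every pair of vertices has enough absorbers, then an embedding of a subtree can be
completed to an embedding of the whole tree. -/
lemma IsEmb.exists_completion [Fintype X] [Fintype V] {G : SimpleGraph V} {D Q : Finset X}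
    {φ : X → V} (hD : τ.IsClosed D) (hφ : τ.IsEmb G D φ) (hQ : τ.IsPool D Q)
    (hXV : Fintype.card X = Fintype.card V)
    (hcount : ∀ y z, Fintype.card V ≤ D.card + (τ.absorbers G φ Q y z).card) :
    ∃ φ' : X → V, φ' τ.root = φ τ.root ∧ τ.IsEmb G Finset.univ φ' := by
  classical
  obtain ⟨Q', φ', -, hroot, hφ', -⟩ := hD.induction_on (p := fun D' => ∃ Q' φ', Q' ⊆ Q ∧
    φ' τ.root = φ τ.root ∧ τ.IsEmb G D' φ' ∧
      ∀ y z, Fintype.card V ≤ D'.card + (τ.absorbers G φ' Q' y z).card)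
    ⟨Q, φ, subset_rfl, rfl, hφ, hcount⟩ (by
      rintro D' x hD' hDD' hx hpar ⟨Q', φ', hQQ', hroot, hφ', hcount'⟩
      have hQ' : τ.IsPool D' Q' := ⟨fun w hw => (hQ.subset w (hQQ' hw)).trans hDD',
        fun w hw => hQ.root_notMem w (hQQ' hw),
        fun w hw w' hw' => hQ.disj w (hQQ' hw) w' (hQQ' hw')⟩
      have hlt : D'.card < Fintype.card V := by
        rw [← hXV]
        exact Finset.card_lt_univ_of_notMem hx
      obtain ⟨z, hz⟩ : ∃ z, z ∉ D'.image φ' := by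
        by_contra! hall
        have h1 := Finset.card_le_card (fun z _ => hall z : Finset.univ ⊆ D'.image φ')
        have h2 : (D'.image φ').card ≤ D'.card := Finset.card_image_le
        rw [Finset.card_univ] at h1
        omega
      obtain ⟨w, hw⟩ : (τ.absorbers G φ' Q' (φ' (τ.par x)) z).Nonempty := by
        rw [← Finset.card_pos]
        have := hcount' (φ' (τ.par x)) z
        omega
      have hwQ := (mem_absorbers.1 hw).1
      refine ⟨Q'.erase w, Function.update (Function.update φ' w z) x (φ' w),
        (Finset.erase_subset _ _).trans hQQ', ?_, hφ'.absorb hD' hQ' hx hpar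
          (fun y hy h => hz (h ▸ Finset.mem_image_of_mem φ' hy)) hw, fun y y' => ?_⟩
      · rw [Function.update_of_ne, Function.update_of_ne, hroot]
        · rintro rfl
          exact hQ'.root_notMem _ hwQ (self_mem_star _)
        · rintro rfl
          exact hx hD'.root_mem
      · have hsub : (τ.absorbers G φ' Q' y y').erase w ⊆ τ.absorbers G
            (Function.update (Function.update φ' w z) x (φ' w)) (Q'.erase w) y y' := by
          intro w' hw'
          obtain ⟨hne, hw'⟩ := Finset.mem_erase.1 hw'
          obtain ⟨hw'Q, h1, h2⟩ := mem_absorbers.1 hw'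
          have hsame : ∀ u ∈ τ.star w',
              Function.update (Function.update φ' w z) x (φ' w) u = φ' u := by
            intro u hu
            rw [Function.update_of_ne, Function.update_of_ne]
            · rintro rfl
              exact Finset.disjoint_left.1 (hQ'.disj w' hw'Q _ hwQ hne) hu (self_mem_star _)
            · rintro rfl
              exact hx (hQ'.subset w' hw'Q hu)
          refine mem_absorbers.2 ⟨Finset.mem_erase.2 ⟨hne, hw'Q⟩, ?_, fun u hu huw => ?_⟩
          · rwa [hsame w' (self_mem_star w')]
          · rw [hsame u hu]
            exact h2 u hu huw
        have h1 := Finset.card_le_card hsub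
        have h2 := Finset.pred_card_le_card_erase (s := τ.absorbers G φ' Q' y y') (a := w)
        have h3 := hcount' y y'
        rw [Finset.card_insert_of_notMem hx]
        omega) (D := Finset.univ) ⟨Finset.mem_univ _, fun _ _ => Finset.mem_univ _⟩
    (Finset.subset_univ _)
  exact ⟨φ', hroot, hφ'⟩

end ParentTree

open Filter in
lemma eventually_const_mul_log_le_sqrt (C : ℝ) :
    ∀ᶠ n : ℕ in atTop, C * (Real.log n + 1) ≤ √(n : ℝ) := by
  have h1 : (fun x : ℝ => Real.log x + 1) =o[atTop] fun x : ℝ => x ^ (1 / 2 : ℝ) := by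
    refine (isLittleO_log_rpow_atTop (by norm_num)).add ?_
    exact Asymptotics.isLittleO_const_left.2
      (Or.inr (tendsto_norm_atTop_atTop.comp (tendsto_rpow_atTop (by norm_num))))
  have h2 := (h1.const_mul_left C).bound one_pos
  filter_upwards [tendsto_natCast_atTop_atTop.eventually h2] with n hn
  rw [one_mul, ← Real.sqrt_eq_rpow, Real.norm_of_nonneg (Real.sqrt_nonneg _)] at hn
  exact (le_abs_self _).trans hn

lemma le_of_half_pow_le {n η M : ℝ} {k q : ℕ} (hn : 0 < n) (hη : η < 1)
    (h : (1 / 2 : ℝ) ^ k ≤ n ^ 2 * (1 - η) ^ q)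
    (hM : 2 * Real.log n + M * Real.log 2 ≤ η * q) : M ≤ k := by
  have h1 : 0 < 1 - η := by linarith
  have h2 := Real.log_le_log (by positivity) h
  rw [Real.log_pow, Real.log_mul (by positivity) (by positivity), Real.log_pow, Real.log_pow,
    one_div, Real.log_inv] at h2
  have h3 := mul_le_mul_of_nonneg_left (Real.log_le_sub_one_of_pos h1) (Nat.cast_nonneg (α := ℝ) q)
  push_cast at h2
  have h4 : M * Real.log 2 ≤ k * Real.log 2 := by linarith
  exact le_of_mul_le_mul_right h4 (Real.log_pos (by norm_num))

namespace ParentTree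

/-- Spanning trees of bounded degree can be embedded with prescribed root as soon as the
parameters of the three stages of the embedding are compatible. -/
lemma exists_isEmb_univ_of_params {X V : Type*} [Fintype X] [DecidableEq X] [Fintype V]
    [DecidableEq V] {τ : ParentTree X} (G : SimpleGraph V) [DecidableRel G.Adj] {n : ℕ}
    (hX : Fintype.card X = n) (hV : Fintype.card V = n) {α β γ ε : ℝ} (hα : 0 < α) (hα2 : α ≤ 1 / 2)
    (hdeg : ∀ v, (1 / 2 + α) * n ≤ ((Finset.univ.filter (G.Adj v)).card : ℝ))
    {Δ K S d : ℕ} (hΔ : ∀ x, (τ.children x).card ≤ Δ) (hS : S = Δ * K + 1)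
    (hγ : γ = α / 4) (hβ0 : 0 < β) (hβ1 : β ≤ 1 / 8)
    (hβ : 2 * β * (2 * (Δ + 2) ^ 2) ≤ 1 / 2 * α ^ (Δ + 2) * γ)
    (hε0 : 0 < ε) (hε1 : ε ≤ 1 / 2) (hε : ε ≤ β * α / 16) (hεK : 1 ≤ ε * K) (hγK : 4 ≤ γ * K)
    (hSd : S ≤ d) (hd : (S : ℝ) ≤ 2 * (α / 4) * d)
    (hlog : 2 * Real.log n + (1 + S) ≤ β * n)
    (hlog' : Real.log n + S / β ^ 2 ≤ √(n : ℝ) * (α / 8))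
    (hdn : 2 * d < ε * (α / 4) * (β * n)) (hSn : √(n : ℝ) * S ≤ β * n)
    (hγn : S + K + Δ + 3 ≤ γ * n / 4) (v : V) :
    ∃ φ : X → V, φ τ.root = v ∧ τ.IsEmb G Finset.univ φ := by
  have hn0 : 0 < n := by
    rw [← hV]
    exact Fintype.card_pos_iff.2 ⟨v⟩
  have hn : (0 : ℝ) < n := by exact_mod_cast hn0
  have hS0 : (0 : ℝ) ≤ S := Nat.cast_nonneg _
  have hK0 : (0 : ℝ) ≤ K := Nat.cast_nonneg _
  have hΔ0 : (0 : ℝ) ≤ Δ := Nat.cast_nonneg _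
  have hγ8 : γ ≤ 1 / 8 := by linarith
  have hγ0 : 0 < γ := by linarith
  have hγn8 : γ * n ≤ 1 / 8 * n := by gcongr
  have hβn8 : β * n ≤ 1 / 8 * n := by gcongr
  obtain ⟨m, hm, hm'⟩ : ∃ m : ℕ, β * n ≤ m ∧ (m : ℝ) ≤ β * n + 1 :=
    ⟨_, Nat.le_ceil _, (Nat.ceil_lt_add_one (by positivity)).le⟩
  obtain ⟨N, hN, hN'⟩ : ∃ N : ℕ, (N : ℝ) ≤ γ * n ∧ γ * n ≤ N + 1 :=
    ⟨_, Nat.floor_le (by positivity), (Nat.lt_floor_add_one _).le⟩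
  have hmn : m ≤ n := by
    have : (m : ℝ) ≤ n := by linarith
    exact_mod_cast this
  have hnm : ((n - m : ℕ) : ℝ) = n - m := Nat.cast_sub hmn
  have huniv : τ.IsClosed Finset.univ := ⟨Finset.mem_univ _, fun _ _ => Finset.mem_univ _⟩
  -- Split the tree into an initial part, a main part and a small rest.
  obtain ⟨E, hE, hEle, hEge, hEB⟩ := exists_build (N := n - m) (K := K) hΔ
    (by
      rw [← hS, ← Nat.cast_le (α := ℝ), hnm]
      linarith)
    (by
      rw [← Nat.cast_le (α := ℝ), hnm]
      linarith) Finset.univ huniv (by rw [Finset.card_univ, hX]; exact Nat.sub_le _ _)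
  rw [← hS] at hEB hEge
  have hEle' : (E.card : ℝ) ≤ n - m := by rw [← hnm]; exact_mod_cast hEle
  have hEge' : (n : ℝ) - m ≤ E.card + S := by rw [← hnm]; exact_mod_cast hEge
  obtain ⟨D, hD, hDle, hDge, hDB⟩ := exists_build (N := N) (K := K) hΔ
    (by
      rw [← hS, ← Nat.cast_le (α := ℝ)]
      linarith)
    (by
      rw [← Nat.cast_le (α := ℝ)]
      linarith) E hE
    (by
      rw [← Nat.cast_le (α := ℝ)]
      linarith)
  rw [← hS] at hDB hDge
  have hDle' : (D.card : ℝ) ≤ N := by exact_mod_cast hDle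
  have hDge' : (N : ℝ) ≤ D.card + S := by exact_mod_cast hDge
  -- The initial part contains a large pool.
  obtain ⟨Q, hQ, hQcard⟩ := hD.exists_isPool hΔ
  have hhang := (hDB.trans hEB).card_hanging_le
  set H := Finset.univ.filter fun x => x ∉ D ∧ τ.par x ∈ D
  rw [Finset.card_univ, hX] at hhang
  have hHn : (H.card : ℝ) ≤ γ * n / 4 := by
    have h1 : (K : ℝ) * H.card ≤ n := by exact_mod_cast (Nat.le_add_right _ _).trans hhang
    have h2 := mul_le_mul_of_nonneg_left h1 hγ0.le
    have h3 := mul_le_mul_of_nonneg_right hγK (Nat.cast_nonneg (α := ℝ) H.card)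
    linarith
  have hQn : γ * n ≤ Q.card * (2 * (Δ + 2) ^ 2) := by
    have : (D.card : ℝ) ≤ Q.card * (Δ + 2) ^ 2 + (H.card + (Δ + 1)) := by exact_mod_cast hQcard
    linarith
  obtain ⟨φ₀, hroot, hφ₀, habs⟩ := exists_absorbing_isEmb G hα (by linarith)
    (by rwa [hV]) hΔ hD (by
      rw [hV]
      have : γ * n ≤ α * n := by gcongr; linarith
      linarith) hQ v
  rw [hV] at habs
  -- The main part.
  have hfree : ((Finset.univ \ D.image φ₀).card : ℝ) ≤ n := by
    rw [← hV]
    exact_mod_cast Finset.card_le_univ _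
  obtain ⟨φ, heq, hφ, -⟩ := hDB.exists_isEmb hD hφ₀ (a₀ := α / 2) (a := α / 4) (ε := ε)
    (lam := √(n : ℝ)) (m₀ := β * n) (by linarith) hε0 hε1 (by positivity) (by positivity) hεK d hd
    hSd hdn hSn rfl
    (by
      rw [hV]
      have h1 : (√(n : ℝ) * (2 * ε) / (β * n) + √(n : ℝ) ^ 2 * S / (β * n) ^ 2) * n =
          √(n : ℝ) * (2 * ε / β) + S / β ^ 2 := by
        rw [Real.sq_sqrt hn.le]
        field_simp
      have h2 : 2 * ε / β ≤ α / 8 := by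
        rw [div_le_iff₀ hβ0]
        linarith
      have h3 := mul_le_mul_of_nonneg_left h2 (Real.sqrt_nonneg (n : ℝ))
      rw [h1]
      nth_rewrite 1 [← Real.exp_log hn]
      rw [← Real.exp_add, ← Real.exp_add, Real.exp_le_exp]
      linarith)
    (by
      intro u
      have h1 : (Finset.univ.filter (G.Adj u)).card ≤
          ((Finset.univ \ D.image φ₀).filter (G.Adj u)).card + (D.image φ₀).card := by
        refine (Finset.card_le_card (t := (Finset.univ \ D.image φ₀).filter (G.Adj u) ∪
          D.image φ₀) fun x hx => ?_).trans (Finset.card_union_le _ _)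
        simp only [Finset.mem_filter, Finset.mem_univ, true_and, Finset.mem_union,
          Finset.mem_sdiff] at hx ⊢
        tauto
      have h2 : (D.image φ₀).card ≤ D.card := Finset.card_image_le
      have h3 : ((Finset.univ.filter (G.Adj u)).card : ℝ) ≤
          ((Finset.univ \ D.image φ₀).filter (G.Adj u)).card + D.card := by
        exact_mod_cast h1.trans (Nat.add_le_add_left h2 _)
      have h4 := hdeg u
      have h5 : (1 / 2 + α / 2) * ((Finset.univ \ D.image φ₀).card : ℝ) ≤
          (1 / 2 + α / 2) * n := by gcongr
      have h6 : γ * n = α * n / 4 := by rw [hγ]; ring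
      linarith [mul_pos hα hn])
    (by
      rw [hV]
      linarith)
  -- Absorb the rest.
  have hDE := hDB.subset
  obtain ⟨φ', hroot', hφ'⟩ := hφ.exists_completion hE (Q := Q)
    ⟨fun w hw => (hQ.subset w hw).trans hDE, hQ.root_notMem, hQ.disj⟩ (hX.trans hV.symm)
    (by
      intro y z
      have hsame : τ.absorbers G φ Q y z = τ.absorbers G φ₀ Q y z := by
        ext w
        simp only [mem_absorbers]
        refine and_congr_right fun hw => ?_
        have h1 : ∀ x ∈ τ.star w, φ x = φ₀ x := fun x hx => heq (hQ.subset w hw hx)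
        rw [h1 w (self_mem_star w)]
        refine and_congr_right fun _ => forall₂_congr fun x hx => ?_
        rw [h1 x hx]
      have hη : 1 / 2 * α ^ (Δ + 2) < 1 := by
        have : α ^ (Δ + 2) ≤ 1 := pow_le_one₀ hα.le (by linarith)
        linarith
      have hcount := le_of_half_pow_le (M := m + S) hn hη (habs y z) (by
        have h1 : ((m : ℝ) + S) * Real.log 2 ≤ (m + S) * 1 := by
          gcongr
          linarith [Real.log_two_lt_d9]
        have h2 : 2 * β * (2 * (Δ + 2) ^ 2) * Q.card ≤ 1 / 2 * α ^ (Δ + 2) * γ * Q.card := by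
          gcongr
        have h3 : 1 / 2 * α ^ (Δ + 2) * (γ * n) ≤
            1 / 2 * α ^ (Δ + 2) * (Q.card * (2 * (Δ + 2) ^ 2)) := by gcongr
        have h4 : 2 * β * (2 * ((Δ : ℝ) + 2) ^ 2) * n ≤ 1 / 2 * α ^ (Δ + 2) * γ * n := by gcongr
        have h5 : 2 * β * n ≤ 1 / 2 * α ^ (Δ + 2) * Q.card := by
          have h6 : (0 : ℝ) < 2 * ((Δ : ℝ) + 2) ^ 2 := by positivity
          refine le_of_mul_le_mul_right ?_ h6
          linarith
        linarith)
      rw [hV, hsame, ← Nat.cast_le (α := ℝ)]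
      push_cast
      linarith)
  refine ⟨φ', ?_, hφ'⟩
  rw [hroot', heq hD.root_mem, hroot]

open Filter in
/-- Spanning trees of bounded degree can be embedded with prescribed root into large graphs whose
minimum degree exceeds half of the order by a linear amount. -/
theorem eventually_exists_isEmb_univ (Δ : ℕ) {α : ℝ} (hα : 0 < α) (hα2 : α ≤ 1 / 2) :
    ∀ᶠ n : ℕ in atTop, ∀ (X V : Type) [Fintype X] [DecidableEq X] [Fintype V] [DecidableEq V]
      (τ : ParentTree X) (G : SimpleGraph V) [DecidableRel G.Adj],
      Fintype.card X = n → Fintype.card V = n →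
      (∀ v, (1 / 2 + α) * n ≤ ((Finset.univ.filter (G.Adj v)).card : ℝ)) →
      (∀ x, (τ.children x).card ≤ Δ) → ∀ v : V,
      ∃ φ : X → V, φ τ.root = v ∧ τ.IsEmb G Finset.univ φ := by
  obtain ⟨γ, hγ⟩ : ∃ γ, γ = α / 4 := ⟨_, rfl⟩
  have hγ0 : 0 < γ := by linarith
  obtain ⟨β, hβ0, hβ1, hβ⟩ : ∃ β : ℝ, 0 < β ∧ β ≤ 1 / 8 ∧
      2 * β * (2 * (Δ + 2) ^ 2) ≤ 1 / 2 * α ^ (Δ + 2) * γ := by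
    refine ⟨min (1 / 8) (1 / 2 * α ^ (Δ + 2) * γ / (4 * (Δ + 2) ^ 2)), by positivity,
      min_le_left _ _, ?_⟩
    have h1 := min_le_right (1 / 8) (1 / 2 * α ^ (Δ + 2) * γ / (4 * ((Δ : ℝ) + 2) ^ 2))
    rw [le_div_iff₀ (by positivity)] at h1
    linarith
  obtain ⟨ε, hε0, hε1, hε⟩ : ∃ ε : ℝ, 0 < ε ∧ ε ≤ 1 / 2 ∧ ε ≤ β * α / 16 :=
    ⟨min (1 / 2) (β * α / 16), by positivity, min_le_left _ _, min_le_right _ _⟩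
  obtain ⟨K, hK⟩ := exists_nat_ge (1 / ε + 4 / γ)
  obtain ⟨S, hS⟩ : ∃ S, S = Δ * K + 1 := ⟨_, rfl⟩
  obtain ⟨d, hd⟩ := exists_nat_ge (S + S / (2 * (α / 4)))
  have hεK : 1 ≤ ε * K := by
    have : 1 / ε ≤ K := le_trans (by linarith [show 0 < 4 / γ by positivity]) hK
    rw [div_le_iff₀ hε0] at this
    linarith
  have hγK : 4 ≤ γ * K := by
    have : 4 / γ ≤ K := le_trans (by linarith [show 0 < 1 / ε by positivity]) hK
    rw [div_le_iff₀ hγ0] at this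
    linarith
  have hSd : S ≤ d := by
    have : (S : ℝ) ≤ d := le_trans (by linarith [show 0 ≤ S / (2 * (α / 4)) by positivity]) hd
    exact_mod_cast this
  have hSd' : (S : ℝ) ≤ 2 * (α / 4) * d := by
    have : S / (2 * (α / 4)) ≤ d := le_trans (by linarith [Nat.cast_nonneg (α := ℝ) S]) hd
    rw [div_le_iff₀ (by positivity)] at this
    linarith
  filter_upwards [eventually_const_mul_log_le_sqrt ((3 + S) / β),
    eventually_const_mul_log_le_sqrt ((1 + S / β ^ 2) / (α / 8)),
    eventually_const_mul_log_le_sqrt ((2 * d + 1) / (ε * (α / 4) * β)),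
    eventually_const_mul_log_le_sqrt ((S + K + Δ + 3) / (γ / 4)), eventually_ge_atTop 1]
    with n h1 h2 h3 h4 hn X V _ _ _ _ τ G _ hX hV hdeg hΔ v
  have hn' : (1 : ℝ) ≤ n := by exact_mod_cast hn
  have hlog : 0 ≤ Real.log n := Real.log_nonneg hn'
  have hsqrt : √(n : ℝ) ≤ n := Real.sqrt_le_iff.2 ⟨by linarith, by nlinarith⟩
  have hscale : ∀ {A B : ℝ}, 0 ≤ A → 0 < B → A / B * (Real.log n + 1) ≤ √(n : ℝ) →
      A * Real.log n + A ≤ B * √(n : ℝ) := by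
    intro A B hA hB h
    rw [div_mul_eq_mul_div, div_le_iff₀ hB] at h
    linarith
  have hle : ∀ {B : ℝ}, 0 < B → B * √(n : ℝ) ≤ B * n := fun hB =>
    mul_le_mul_of_nonneg_left hsqrt hB.le
  have hS0 : (0 : ℝ) ≤ S := Nat.cast_nonneg _
  replace h1 := hscale (by positivity) hβ0 h1
  replace h2 := hscale (by positivity) (by positivity) h2
  replace h3 := hscale (by positivity) (by positivity) h3
  replace h4 := hscale (by positivity) (by positivity) h4
  refine exists_isEmb_univ_of_params G hX hV hα hα2 hdeg hΔ hS hγ hβ0 hβ1 hβ hε0 hε1 hε hεK hγK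
    hSd hSd' ?_ ?_ ?_ ?_ ?_ v
  · linarith [hle hβ0, mul_nonneg hS0 hlog]
  · linarith [mul_nonneg (show 0 ≤ S / β ^ 2 by positivity) hlog]
  · linarith [hle (show 0 < ε * (α / 4) * β by positivity),
      mul_nonneg (show (0 : ℝ) ≤ 2 * d + 1 by positivity) hlog]
  · have h5 : (S : ℝ) ≤ β * √(n : ℝ) := by linarith [mul_nonneg hS0 hlog]
    have h6 := mul_le_mul_of_nonneg_left h5 (Real.sqrt_nonneg (n : ℝ))
    have h7 := Real.mul_self_sqrt (Nat.cast_nonneg (α := ℝ) n)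
    calc √(n : ℝ) * S ≤ √(n : ℝ) * (β * √(n : ℝ)) := h6
      _ = β * (√(n : ℝ) * √(n : ℝ)) := by ring
      _ = β * n := by rw [h7]
  · linarith [hle (show 0 < γ / 4 by positivity),
      mul_nonneg (show (0 : ℝ) ≤ S + K + Δ + 3 by positivity) hlog]

end ParentTree

/-- A tree with a chosen root. -/
lemma SimpleGraph.IsTree.exists_parentTree {X : Type*} {T : SimpleGraph X} (hT : T.IsTree) (t : X) :
    ∃ τ : ParentTree X, τ.root = t ∧ (∀ x, x ≠ t → T.Adj x (τ.par x)) ∧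
      ∀ a b, T.Adj a b → (a ≠ t ∧ τ.par a = b) ∨ (b ≠ t ∧ τ.par b = a) := by
  choose p hp hlen using fun x => hT.connected.exists_path_of_dist x t
  have hnil : ∀ x, x ≠ t → ¬ (p x).Nil := fun x hx => SimpleGraph.Walk.not_nil_of_ne hx
  have hpar : ∀ a b, T.Adj a b → T.dist a t = T.dist b t + 1 → a ≠ t ∧ (p a).snd = b := by
    intro a b hab hd
    have hat : a ≠ t := by
      rintro rfl
      simp at hd
    have hq : (SimpleGraph.Walk.cons hab (p b)).IsPath :=
      SimpleGraph.Walk.isPath_of_length_eq_dist _ (by simp [hlen, hd])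
    have : p a = SimpleGraph.Walk.cons hab (p b) := (hT.existsUnique_path a t).unique (hp a) hq
    exact ⟨hat, by simp [this]⟩
  refine ⟨⟨t, fun x => (p x).snd, fun x => T.dist x t, ?_, ?_⟩, rfl, ?_, ?_⟩
  · exact (p t).getVert_of_length_le (by simp [hlen])
  · intro x hx
    have hadj := (p x).adj_snd (hnil x hx)
    have h1 := SimpleGraph.Walk.length_tail_add_one (hnil x hx)
    have h2 := SimpleGraph.dist_le (p x).tail
    have h3 := hadj.diff_dist_adj (u := t)
    rw [SimpleGraph.dist_comm (u := t), SimpleGraph.dist_comm (u := t)] at h3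
    rw [hlen] at h1
    omega
  · exact fun x hx => (p x).adj_snd (hnil x hx)
  · intro a b hab
    have h := hT.dist_eq_dist_add_one_of_adj t hab
    rw [SimpleGraph.dist_comm (u := t), SimpleGraph.dist_comm (u := t)] at h
    rcases h with h | h
    · exact Or.inl (hpar a b hab h)
    · exact Or.inr (hpar b a hab.symm h)

/-- rooted tree embedding theorem.
For every `Δ ∈ ℕ` and `α > 0` there is `n₀` such that for all `n ≥ n₀`: if `G` is an
`n`-vertex graph with `δ(G) ≥ (1/2+α)n`, `T` is an `n`-vertex tree with `Δ(T) ≤ Δ`,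
`t ∈ V(T)` and `v ∈ V(G)`, then `G` contains a copy of `T` with `t` copied to `v`,
i.e. there is an injective graph homomorphism `φ : V(T) → V(G)` with `φ(t) = v`. -/
theorem stmt_13 (Δ : ℕ) (α : ℝ) (hα : 0 < α) :
    ∃ n₀ : ℕ, ∀ n : ℕ, n₀ ≤ n →
      ∀ (G T : SimpleGraph (Fin n)) [DecidableRel G.Adj] [DecidableRel T.Adj],
        (1 / 2 + α) * n ≤ (G.minDegree : ℝ) →
        T.IsTree → T.maxDegree ≤ Δ →
        ∀ t v : Fin n,
          ∃ f : Fin n → Fin n,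
            Function.Injective f ∧ (∀ a b, T.Adj a b → G.Adj (f a) (f b)) ∧ f t = v := by
  obtain ⟨n₀, hn₀⟩ := Filter.eventually_atTop.1 (ParentTree.eventually_exists_isEmb_univ Δ
    (α := min α (1 / 2)) (by positivity) (min_le_right _ _))
  refine ⟨n₀, fun n hn G T _ _ hG hT hTΔ t v => ?_⟩
  obtain ⟨τ, rfl, hadj, hpar⟩ := hT.exists_parentTree t
  obtain ⟨φ, hroot, hφ⟩ := hn₀ n hn (Fin n) (Fin n) τ G (Fintype.card_fin n) (Fintype.card_fin n)
    (by
      intro u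
      have h1 : (1 / 2 + min α (1 / 2)) * (n : ℝ) ≤ (1 / 2 + α) * n := by
        gcongr
        exact min_le_left _ _
      have h2 : (G.minDegree : ℝ) ≤ G.degree u := by exact_mod_cast G.minDegree_le_degree u
      rw [← SimpleGraph.neighborFinset_eq_filter, SimpleGraph.card_neighborFinset_eq_degree]
      linarith)
    (by
      intro x
      refine le_trans ?_ ((T.degree_le_maxDegree x).trans hTΔ)
      rw [← SimpleGraph.card_neighborFinset_eq_degree]
      refine Finset.card_le_card fun y hy => ?_
      obtain ⟨hyr, rfl⟩ := ParentTree.mem_children.1 hy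
      rw [SimpleGraph.mem_neighborFinset]
      exact (hadj y hyr).symm) v
  refine ⟨φ, fun a b h => hφ.inj (by simp) (by simp) h, fun a b hab => ?_, hroot⟩
  rcases hpar a b hab with ⟨h, rfl⟩ | ⟨h, rfl⟩
  · exact (hφ.adj a (Finset.mem_univ _) h).symm
  · exact hφ.adj b (Finset.mem_univ _) h
end

section
/- There exists an absolute constant C > 0 with the following property: if G is a balanced bipartite graph on 2n vertices (both parts of size n) with minimum degree δ(G) ≥ 3n/4, then there exists a random perfect matching M of G such that for any collection of distinct edges e₁,…,e_s ∈ E(G), the probability that all of e₁,…,e_s belong to M is at most (C/n)^s. -/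
open Finset in
/-- If every vertex misses at most a quarter of the other side, then for every bijection `g` and
every `a`, at least half of all `x`, minus any forbidden set `K`, can be switched with `a`. -/
lemma card_switchable_ge {A B : Type} [Fintype A] [Fintype B] [DecidableEq A]
    (E : A → B → Prop) [∀ a b, Decidable (E a b)]
    (hA : ∀ a, (#{b | ¬ E a b} : ℝ) ≤ Fintype.card A / 4)
    (hB : ∀ b, (#{a | ¬ E a b} : ℝ) ≤ Fintype.card A / 4)
    (g : A ≃ B) (a : A) (K : Finset A) :
    (Fintype.card A : ℝ) / 2 - #K ≤ #{x | x ∉ K ∧ E a (g x) ∧ E x (g a)} := by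
  have hcover : (univ : Finset A) ⊆ ({x | x ∉ K ∧ E a (g x) ∧ E x (g a)} : Finset A) ∪
      (K ∪ (({x | ¬ E a (g x)} : Finset A) ∪ ({x | ¬ E x (g a)} : Finset A))) := by
    intro x _
    simp only [mem_union, mem_filter, mem_univ, true_and]
    tauto
  have hcard := (card_le_card hcover).trans ((card_union_le _ _).trans (Nat.add_le_add_left
    ((card_union_le _ _).trans (Nat.add_le_add_left (card_union_le _ _) _)) _))
  have hmap : #{x | ¬ E a (g x)} = #{b | ¬ E a b} :=
    card_bij (fun x _ => g x) (by simp) (fun x _ y _ h => g.injective h)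
      (fun b hb => ⟨g.symm b, by simpa using hb, by simp⟩)
  rw [hmap, card_univ] at hcard
  have hcard' : (Fintype.card A : ℝ) ≤ #{x | x ∉ K ∧ E a (g x) ∧ E x (g a)} +
      (#K + (#{b | ¬ E a b} + #{x | ¬ E x (g a)})) := by exact_mod_cast hcard
  linarith [hA a, hB (g a)]

open Finset in
/-- Fixing one more edge divides the number of perfect matchings by at least `n / 4`, as long as
at most `n / 4` edges are fixed. -/
lemma card_matchings_insert_mul_le {A B : Type} [Fintype A] [Fintype B] [DecidableEq A]
    [DecidableEq B] (E : A → B → Prop) [∀ a b, Decidable (E a b)]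
    (hA : ∀ a, (#{b | ¬ E a b} : ℝ) ≤ Fintype.card A / 4)
    (hB : ∀ b, (#{a | ¬ E a b} : ℝ) ≤ Fintype.card A / 4)
    (f : A → B) (a : A) (T : Finset A) (ha : a ∉ T)
    (hT : (#(insert a T) : ℝ) ≤ Fintype.card A / 4) :
    (#{g : A ≃ B | (∀ x, E x (g x)) ∧ ∀ x ∈ insert a T, g x = f x} : ℝ) *
        (Fintype.card A / 4) ≤
      #{g : A ≃ B | (∀ x, E x (g x)) ∧ ∀ x ∈ T, g x = f x} := by
  set S : Finset (A ≃ B) := {g | (∀ x, E x (g x)) ∧ ∀ x ∈ insert a T, g x = f x} with hS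
  let P : (A ≃ B) → Finset A := fun g => {x | x ∉ insert a T ∧ E a (g x) ∧ E x (g a)}
  have hP : ∀ g ∈ S, (Fintype.card A : ℝ) / 4 ≤ #(P g) := fun g _ => by
    have := card_switchable_ge E hA hB g a (insert a T)
    simp only [P]
    linarith
  have hle : #(S.sigma P) ≤
      #{g : A ≃ B | (∀ x, E x (g x)) ∧ ∀ x ∈ T, g x = f x} := by
    refine card_le_card_of_injOn (fun p => (Equiv.swap a p.2).trans p.1) ?_ ?_
    · rintro ⟨g, y⟩ hp
      simp only [coe_sigma, Set.mem_sigma_iff, mem_coe, hS, P, mem_filter, mem_univ, true_and,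
        mem_insert, not_or] at hp
      obtain ⟨⟨hg, hgf⟩, ⟨hya, hyT⟩, hay, hya'⟩ := hp
      simp only [coe_filter, mem_univ, true_and, Set.mem_ofPred_eq, Equiv.trans_apply]
      refine ⟨fun x => ?_, fun x hx => ?_⟩
      · rcases eq_or_ne x a with rfl | hxa
        · simpa using hay
        rcases eq_or_ne x y with rfl | hxy
        · simpa using hya'
        · simpa [Equiv.swap_apply_of_ne_of_ne hxa hxy] using hg x
      · rw [Equiv.swap_apply_of_ne_of_ne (ne_of_mem_of_not_mem hx ha)
          (ne_of_mem_of_not_mem hx hyT)]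
        exact hgf x (Or.inr hx)
    · rintro ⟨g, y⟩ hp ⟨g', y'⟩ hp' h
      simp only [coe_sigma, Set.mem_sigma_iff, mem_coe, hS, mem_filter, mem_univ,
        true_and] at hp hp'
      have hga : g a = g' a := by
        rw [hp.1.2 a (mem_insert_self _ _), hp'.1.2 a (mem_insert_self _ _)]
      simp only at h
      have hy : y = y' := by
        apply ((Equiv.swap a y').trans g').injective
        have h1 : ((Equiv.swap a y').trans g') y = g a := by rw [← h]; simp
        rw [h1, hga]; simp
      subst hy
      have hg : g = g' := by
        ext x
        have := DFunLike.congr_fun h (Equiv.swap a y x)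
        simpa using this
      subst hg
      rfl
  calc (#S : ℝ) * (Fintype.card A / 4) = ∑ g ∈ S, (Fintype.card A : ℝ) / 4 := by simp
    _ ≤ ∑ g ∈ S, (#(P g) : ℝ) := sum_le_sum hP
    _ = #(S.sigma P) := by rw [card_sigma]; push_cast; rfl
    _ ≤ _ := by exact_mod_cast hle

open Finset in
lemma card_matchings_agreeing_mul_le {A B : Type} [Fintype A] [Fintype B] [DecidableEq A]
    [DecidableEq B] (E : A → B → Prop) [∀ a b, Decidable (E a b)]
    (hA : ∀ a, (#{b | ¬ E a b} : ℝ) ≤ Fintype.card A / 4)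
    (hB : ∀ b, (#{a | ¬ E a b} : ℝ) ≤ Fintype.card A / 4)
    (f : A → B) (T : Finset A) (hT : (#T : ℝ) ≤ Fintype.card A / 4) :
    (#{g : A ≃ B | (∀ x, E x (g x)) ∧ ∀ x ∈ T, g x = f x} : ℝ) *
        (Fintype.card A / 4) ^ #T ≤
      #{g : A ≃ B | ∀ x, E x (g x)} := by
  induction T using Finset.induction_on with
  | empty => simp
  | insert a T ha ih =>
    have hT' : (#T : ℝ) ≤ Fintype.card A / 4 :=
      le_trans (by exact_mod_cast card_le_card (subset_insert a T)) hT
    refine le_trans ?_ (ih hT')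
    rw [card_insert_of_notMem ha, pow_succ', ← mul_assoc]
    gcongr
    exact card_matchings_insert_mul_le E hA hB f a T ha hT

open Finset in
/-- The bijections number at most `exp (2 n)` times the perfect matchings: the generating function
`Z t = ∑ g, t ^ (number of non-edges of g)` grows at rate at most `2 n Z` on `[0, 1]` by switching. -/
lemma card_equiv_le_exp_mul_card_matchings {A B : Type} [Fintype A] [Fintype B] [DecidableEq A]
    [DecidableEq B] (E : A → B → Prop) [∀ a b, Decidable (E a b)] [Nonempty A]
    (hA : ∀ a, (#{b | ¬ E a b} : ℝ) ≤ Fintype.card A / 4)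
    (hB : ∀ b, (#{a | ¬ E a b} : ℝ) ≤ Fintype.card A / 4) :
    (Fintype.card (A ≃ B) : ℝ) ≤
      Real.exp (2 * Fintype.card A) * #{g : A ≃ B | ∀ x, E x (g x)} := by
  set n : ℝ := (Fintype.card A : ℝ) with hn
  have hn0 : 0 < n := by rw [hn]; exact_mod_cast Fintype.card_pos
  let bad : (A ≃ B) → Finset A := fun g => {x | ¬ E x (g x)}
  let Z : ℝ → ℝ := fun t => ∑ g : A ≃ B, t ^ #(bad g)
  let Z' : ℝ → ℝ := fun t => ∑ g : A ≃ B, (#(bad g) : ℝ) * t ^ (#(bad g) - 1)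
  have hZ : ∀ t, HasDerivAt Z (Z' t) t := fun t =>
    HasDerivAt.fun_sum fun g _ => hasDerivAt_pow _ t
  have hswitch : ∀ g : A ≃ B, ∀ a ∈ bad g, ∀ x, E a (g x) → E x (g a) →
      #(bad ((Equiv.swap a x).trans g)) ≤ #(bad g) - 1 := by
    intro g a ha x hax hxa
    rw [← card_erase_of_mem ha]
    refine card_le_card fun y hy => ?_
    simp only [bad, mem_filter, mem_univ, true_and, mem_erase] at hy ⊢
    rw [Equiv.trans_apply] at hy
    rcases eq_or_ne y a with rfl | hya
    · simp [hax] at hy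
    rcases eq_or_ne y x with rfl | hyx
    · simp [hxa] at hy
    rw [Equiv.swap_apply_of_ne_of_ne hya hyx] at hy
    exact ⟨hya, hy⟩
  have hZ' : ∀ t, 0 ≤ t → t ≤ 1 → Z' t ≤ 2 * n * Z t := by
    intro t ht0 ht1
    have hbound : Z' t * (n / 2) ≤ n * (n * Z t) := by
      calc Z' t * (n / 2)
          = ∑ g : A ≃ B, ∑ a ∈ bad g, (n / 2) * t ^ (#(bad g) - 1) := by
            simp only [Z', sum_mul, sum_const, nsmul_eq_mul]
            exact sum_congr rfl fun g _ => by ring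
        _ ≤ ∑ g : A ≃ B, ∑ a ∈ bad g, ∑ x with E a (g x) ∧ E x (g a),
              t ^ #(bad ((Equiv.swap a x).trans g)) := by
            refine sum_le_sum fun g _ => sum_le_sum fun a ha => ?_
            calc (n / 2) * t ^ (#(bad g) - 1)
                ≤ #{x | E a (g x) ∧ E x (g a)} * t ^ (#(bad g) - 1) := by
                  gcongr
                  simpa using card_switchable_ge E hA hB g a ∅
              _ = ∑ x with E a (g x) ∧ E x (g a), t ^ (#(bad g) - 1) := by simp
              _ ≤ _ := by
                  refine sum_le_sum fun x hx => ?_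
                  simp only [mem_filter, mem_univ, true_and] at hx
                  exact pow_le_pow_of_le_one ht0 ht1 (hswitch g a ha x hx.1 hx.2)
        _ ≤ ∑ g : A ≃ B, ∑ a, ∑ x, t ^ #(bad ((Equiv.swap a x).trans g)) := by
            refine sum_le_sum fun g _ => ?_
            refine (sum_le_sum fun a _ => sum_le_sum_of_subset_of_nonneg (subset_univ _)
              fun x _ _ => by positivity).trans ?_
            exact sum_le_sum_of_subset_of_nonneg (subset_univ _) fun a _ _ => by positivity
        _ = ∑ a : A, ∑ x : A, ∑ g : A ≃ B, t ^ #(bad ((Equiv.swap a x).trans g)) := by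
            rw [sum_comm]
            exact sum_congr rfl fun a _ => sum_comm
        _ = ∑ a : A, ∑ x : A, Z t := by
            refine sum_congr rfl fun a _ => sum_congr rfl fun x _ => ?_
            exact Equiv.sum_comp ((Equiv.swap a x).equivCongr (Equiv.refl B))
              (fun g => t ^ #(bad g))
        _ = n * (n * Z t) := by simp [hn]
    have : n / 2 * Z' t ≤ n / 2 * (2 * n * Z t) := by linarith
    exact le_of_mul_le_mul_left this (by positivity)
  have hderiv : ∀ t, HasDerivAt (fun t => Real.exp (-(2 * n * t)) * Z t)
      (Real.exp (-(2 * n * t)) * (-(2 * n * 1)) * Z t + Real.exp (-(2 * n * t)) * Z' t) t :=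
    fun t => ((((hasDerivAt_id t).const_mul (2 * n)).neg).exp).mul (hZ t)
  have hanti : AntitoneOn (fun t => Real.exp (-(2 * n * t)) * Z t) (Set.Icc 0 1) := by
    refine antitoneOn_of_deriv_nonpos (convex_Icc 0 1)
      (fun t _ => (hderiv t).continuousAt.continuousWithinAt)
      (fun t _ => (hderiv t).differentiableAt.differentiableWithinAt) fun t ht => ?_
    rw [interior_Icc] at ht
    rw [(hderiv t).deriv]
    nlinarith [hZ' t ht.1.le ht.2.le, Real.exp_pos (-(2 * n * t))]
  have h01 := hanti (Set.left_mem_Icc.2 zero_le_one) (Set.right_mem_Icc.2 zero_le_one) zero_le_one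
  have hZ1 : Z 1 = Fintype.card (A ≃ B) := by simp [Z]
  have hZ0 : Z 0 = #{g : A ≃ B | ∀ x, E x (g x)} := by
    simp [Z, bad, zero_pow_eq, card_eq_zero, filter_eq_empty_iff]
  simp only [hZ1, hZ0, mul_one, mul_zero, neg_zero, Real.exp_zero, one_mul] at h01
  rw [Real.exp_neg, inv_mul_le_iff₀ (Real.exp_pos _)] at h01
  exact h01

open Finset in
lemma card_equivs_agreeing_le {A B : Type} [Fintype A] [Fintype B] [DecidableEq A]
    [DecidableEq B] (f : A → B) (T : Finset A) :
    #{g : A ≃ B | ∀ x ∈ T, g x = f x} ≤ Fintype.card B ^ (Fintype.card A - #T) := by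
  have hcard : Fintype.card ({x // x ∉ T} → B) = Fintype.card B ^ (Fintype.card A - #T) := by
    rw [Fintype.card_fun, Fintype.card_subtype_compl, Fintype.card_coe]
  rw [← hcard, ← card_univ]
  refine card_le_card_of_injOn (fun g x => g x) (by simp) fun g hg g' hg' h => ?_
  simp only [coe_filter, mem_univ, true_and, Set.mem_ofPred_eq] at hg hg'
  ext x
  by_cases hx : x ∈ T
  · rw [hg x hx, hg' x hx]
  · exact congr_fun h ⟨x, hx⟩

open Finset in
/-- The uniform distribution on perfect matchings is spread, in counting form. -/
lemma card_matchings_agreeing_le {A B : Type} [Fintype A] [Fintype B] [DecidableEq A]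
    [DecidableEq B] (E : A → B → Prop) [∀ a b, Decidable (E a b)] [Nonempty A]
    (hAB : Fintype.card A = Fintype.card B)
    (hA : ∀ a, (#{b | ¬ E a b} : ℝ) ≤ Fintype.card A / 4)
    (hB : ∀ b, (#{a | ¬ E a b} : ℝ) ≤ Fintype.card A / 4)
    (f : A → B) (T : Finset A) :
    (#{g : A ≃ B | (∀ x, E x (g x)) ∧ ∀ x ∈ T, g x = f x} : ℝ) ≤
      (Real.exp 12 / Fintype.card A) ^ #T * #{g : A ≃ B | ∀ x, E x (g x)} := by
  have hn0 : (0 : ℝ) < Fintype.card A := by exact_mod_cast Fintype.card_pos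
  rcases le_or_gt (#T : ℝ) (Fintype.card A / 4) with hT | hT
  · have h := card_matchings_agreeing_mul_le E hA hB f T hT
    have hpos : (0 : ℝ) < (Fintype.card A / 4) ^ #T := by positivity
    rw [← le_div_iff₀ hpos, div_eq_inv_mul, ← inv_pow, inv_div] at h
    refine h.trans ?_
    gcongr
    linarith [Real.add_one_le_exp (12 : ℝ)]
  · have hcount : (#{g : A ≃ B | (∀ x, E x (g x)) ∧ ∀ x ∈ T, g x = f x} : ℝ) ≤
        (Fintype.card A : ℝ) ^ (Fintype.card A - #T) := by
      have h := card_equivs_agreeing_le f T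
      rw [← hAB] at h
      refine le_trans (Nat.cast_le.2 (card_le_card ?_)) (by exact_mod_cast h)
      exact monotone_filter_right _ fun g _ hg => hg.2
    have htotal := card_equiv_le_exp_mul_card_matchings E hA hB
    rw [Fintype.card_equiv (Fintype.equivOfCardEq hAB)] at htotal
    have hfact := Real.pow_div_factorial_le_exp (Fintype.card A : ℝ) hn0.le (Fintype.card A)
    rw [div_le_iff₀ (by positivity)] at hfact
    have hsplit : (Fintype.card A : ℝ) ^ (Fintype.card A - #T) * (Fintype.card A : ℝ) ^ #T =
        (Fintype.card A : ℝ) ^ Fintype.card A := by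
      rw [← pow_add, Nat.sub_add_cancel (card_le_univ T)]
    rw [div_pow, div_mul_eq_mul_div, le_div_iff₀ (by positivity), ← Real.exp_nat_mul]
    calc _ ≤ (Fintype.card A : ℝ) ^ (Fintype.card A - #T) * (Fintype.card A : ℝ) ^ #T := by
            gcongr
      _ ≤ Real.exp (Fintype.card A) * (Fintype.card A).factorial := hsplit ▸ hfact
      _ ≤ Real.exp (Fintype.card A) * (Real.exp (2 * Fintype.card A) * _) := by gcongr
      _ = Real.exp (Fintype.card A + 2 * Fintype.card A) * _ := by rw [Real.exp_add, mul_assoc]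
      _ ≤ _ := by
        gcongr
        linarith

lemma card_filter_not_le_quarter {α : Type} [Fintype α] (p : α → Prop) [DecidablePred p]
    (h : 3 * (Fintype.card α : ℝ) / 4 ≤ (Nat.card {x // p x} : ℝ)) :
    ((Finset.univ.filter fun x => ¬ p x).card : ℝ) ≤ Fintype.card α / 4 := by
  have hsum := Finset.card_filter_add_card_filter_not (s := (Finset.univ : Finset α)) p
  rw [Nat.card_eq_fintype_card, Fintype.card_subtype] at h
  rw [Finset.card_univ] at hsum
  have hsum' : ((Finset.univ.filter fun x => p x).card : ℝ) +
      (Finset.univ.filter fun x => ¬ p x).card = Fintype.card α := by exact_mod_cast hsum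
  linarith

/-- spread perfect matchings, Lemma 3.1 in Kelly–Müyesser–Pokrovskiy.
There is an absolute constant `C > 0` such that: if `G` is a balanced bipartite
graph with parts `A`, `B` of size `n` (encoded by the adjacency relation
`E : A → B → Prop`) and minimum degree at least `3n/4`, then there is a random
perfect matching `M` (a probability distribution over bijections `g : A ≃ B`
using only edges of `G`) such that for any distinct edges `e₁,…,e_s ∈ E(G)`,
the probability that all of them belong to `M` is at most `(C/n)^s`. -/
theorem stmt_14 :
    ∃ C : ℝ, 0 < C ∧
      ∀ (n : ℕ) (A B : Type) [Fintype A] [Fintype B] (E : A → B → Prop),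
        Fintype.card A = n → Fintype.card B = n →
        (∀ a : A, 3 * (n : ℝ) / 4 ≤ (Nat.card {b : B // E a b} : ℝ)) →
        (∀ b : B, 3 * (n : ℝ) / 4 ≤ (Nat.card {a : A // E a b} : ℝ)) →
        ∃ μ : PMF {g : A ≃ B // ∀ a, E a (g a)},
          ∀ (s : ℕ) (a : Fin s → A) (b : Fin s → B),
            (∀ i, E (a i) (b i)) →
            Function.Injective (fun i => (a i, b i)) →
            μ.toOuterMeasure {g | ∀ i, g.1 (a i) = b i} ≤
              ENNReal.ofReal ((C / n) ^ s) := by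
  classical
  refine ⟨Real.exp 12, Real.exp_pos _, ?_⟩
  intro n A B _ _ E hcA hcB hdA hdB
  have hAB : Fintype.card A = Fintype.card B := hcA.trans hcB.symm
  rcases isEmpty_or_nonempty A with hempty | hne
  · have : IsEmpty B := Fintype.card_eq_zero_iff.1 (hAB ▸ Fintype.card_eq_zero)
    refine ⟨PMF.pure ⟨Equiv.equivOfIsEmpty A B, fun a => isEmptyElim a⟩, fun s a b _ _ => ?_⟩
    have hs : s = 0 := by
      by_contra h
      exact isEmptyElim (a ⟨0, Nat.pos_of_ne_zero h⟩)
    subst hs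
    rw [pow_zero, ENNReal.ofReal_one]
    refine (MeasureTheory.measure_mono (Set.subset_univ _)).trans ?_
    exact ((PMF.toOuterMeasure_apply_eq_one_iff _ _).2 (Set.subset_univ _)).le
  have hA : ∀ a, ((Finset.univ.filter fun b => ¬ E a b).card : ℝ) ≤ Fintype.card A / 4 :=
    fun a => hAB ▸ card_filter_not_le_quarter (E a) (hcB ▸ hdA a)
  have hB : ∀ b, ((Finset.univ.filter fun a => ¬ E a b).card : ℝ) ≤ Fintype.card A / 4 :=
    fun b => card_filter_not_le_quarter (fun a => E a b) (hcA ▸ hdB b)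
  have hpos : 0 < (Finset.univ.filter fun g : A ≃ B => ∀ x, E x (g x)).card := by
    have htotal := card_equiv_le_exp_mul_card_matchings E hA hB
    have hequiv : 0 < Fintype.card (A ≃ B) :=
      Fintype.card_pos_iff.2 ⟨Fintype.equivOfCardEq hAB⟩
    by_contra h
    rw [Nat.eq_zero_of_not_pos h, Nat.cast_zero, mul_zero] at htotal
    exact absurd hequiv (by exact_mod_cast htotal.not_gt)
  have : Nonempty {g : A ≃ B // ∀ a, E a (g a)} := by
    obtain ⟨g, hg⟩ := Finset.card_pos.1 hpos
    exact ⟨g, (Finset.mem_filter.1 hg).2⟩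
  refine ⟨PMF.uniformOfFintype _, fun s a b _ hinj => ?_⟩
  rcases Set.eq_empty_or_nonempty
    {g : {g : A ≃ B // ∀ a, E a (g a)} | ∀ i, g.1 (a i) = b i} with hS | ⟨g₀, hg₀⟩
  · rw [hS]; simp
  have ha : Function.Injective a := fun i j hij =>
    hinj (Prod.ext hij (by simp only [← hg₀ i, ← hg₀ j, hij]))
  have hT : (Finset.univ.image a).card = s := by
    rw [Finset.card_image_of_injective _ ha, Finset.card_univ, Fintype.card_fin]
  have hcard : Fintype.card
      {g : {g : A ≃ B // ∀ a, E a (g a)} | ∀ i, g.1 (a i) = b i} =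
      (Finset.univ.filter fun g : A ≃ B =>
        (∀ x, E x (g x)) ∧ ∀ x ∈ Finset.univ.image a, g x = g₀.1 x).card := by
    rw [← Fintype.card_subtype]
    refine Fintype.card_congr ((Equiv.subtypeSubtypeEquivSubtypeInter _
      (fun g : A ≃ B => ∀ i, g (a i) = b i)).trans (Equiv.subtypeEquivRight fun g => ?_))
    have hb : ∀ i, b i = g₀.1 (a i) := fun i => (hg₀ i).symm
    simp [hb]
  have hmain := card_matchings_agreeing_le E hAB hA hB g₀.1 (Finset.univ.image a)
  rw [hT, ← hcard, ← Fintype.card_subtype, hcA] at hmain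
  rw [PMF.toOuterMeasure_uniformOfFintype_apply]
  refine ENNReal.div_le_of_le_mul ?_
  rw [← ENNReal.ofReal_natCast, ← ENNReal.ofReal_natCast, ← ENNReal.ofReal_mul (by positivity)]
  exact ENNReal.ofReal_le_ofReal hmain
end
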